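/- arXiv:2102.06134 — 2 statements merged into one kernel-verified Lean document; each statement's English description precedes it below -/
import Mathlib

section
/- There exists an acyclic oriented matroid of rank 4 on 12 elements that is not the little oriented matroid of any sweep oriented matroid; specifically, a suitable reorientation of Richter-Gebert's oriented matroid RG (which has two topes U, T such that no single-element extension by a pseudoplane has a covector below both U and T) cannot be extended to a big oriented matroid. -/
/-- The set `E_n = {(i,j) : 1 ≤ i < j ≤ n}`. -/
abbrev Pairs (n : ℕ) := {p : Fin n × Fin n // p.1 < p.2}

/-- Composition of sign vectors: `(X ∘ Y)_e = X_e` if `X_e ≠ 0`, else `Y_e`. -/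
def signComp {E : Type*} (X Y : E → SignType) : E → SignType :=
  fun e => if X e = 0 then Y e else X e

/-- The covector axioms for oriented matroids: (V0) the zero vector belongs, (V1)
closure under negation, (V2) closure under composition, (V3) covector elimination. -/
def IsOrientedMatroid {E : Type*} (C : Set (E → SignType)) : Prop :=
  (fun _ => 0) ∈ C ∧
  (∀ X ∈ C, -X ∈ C) ∧
  (∀ X ∈ C, ∀ Y ∈ C, signComp X Y ∈ C) ∧
  (∀ X ∈ C, ∀ Y ∈ C, ∀ e, X e ≠ 0 → X e = -Y e →
    ∃ Z ∈ C, Z e = 0 ∧ ∀ f, ¬(X f ≠ 0 ∧ X f = -Y f) → Z f = signComp X Y f)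

/-- The conformal (componentwise) partial order on sign vectors: `0 ≺ +`, `0 ≺ -`. -/
def covLE {E : Type*} (X Y : E → SignType) : Prop := ∀ e, X e = 0 ∨ X e = Y e

/-- A covector of the braid oriented matroid on `E_n`: the sign vector obtained from
an ordered partition of `[n]` (given by a surjection `p`) via
`X_{(i,j)} = sign (p j - p i)`. -/
def IsBraidCovector {n : ℕ} (X : Pairs n → SignType) : Prop :=
  ∃ (l : ℕ) (p : Fin n → Fin l), Function.Surjective p ∧
    ∀ e : Pairs n, X e =
      if p e.1.1 < p e.1.2 then 1 else if p e.1.2 < p e.1.1 then -1 else 0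

/-- The covectors `X^k` of the big oriented matroid of a sweep oriented matroid, on
the ground set `[n] ∪ E_n`: for each covector `X`, with associated surjection
`p : [n] → [l]` (values of `p` are shifted by one to match the paper's `p_X : [n] → [l]`),
and each `1 ≤ k ≤ 2l+1`, the sign vector which is `-` on `i` with `p_X(i) ≤ ⌊(k-1)/2⌋`,
`+` on `i` with `p_X(i) > ⌊k/2⌋`, `0` on the remaining `i` (only for `k` even, where
`p_X(i) = k/2`), and agrees with `X` on `E_n`. -/
def BigCovectors {n : ℕ} (C : Set (Pairs n → SignType)) :
    Set ((Fin n ⊕ Pairs n) → SignType) :=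
  { Z | ∃ X ∈ C, ∃ (l : ℕ) (p : Fin n → Fin l), Function.Surjective p ∧
      (∀ e : Pairs n, X e =
        if p e.1.1 < p e.1.2 then 1 else if p e.1.2 < p e.1.1 then -1 else 0) ∧
      ∃ k : ℕ, 1 ≤ k ∧ k ≤ 2 * l + 1 ∧
        (∀ i : Fin n, Z (Sum.inl i) =
          if (p i : ℕ) + 1 ≤ (k - 1) / 2 then -1
          else if k / 2 < (p i : ℕ) + 1 then 1 else 0) ∧
        (∀ e : Pairs n, Z (Sum.inr e) = X e) }

/-- The little oriented matroid of a sweep oriented matroid: the restriction of its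
big oriented matroid to the ground set `[n]`. -/
def LittleCovectors {n : ℕ} (C : Set (Pairs n → SignType)) : Set (Fin n → SignType) :=
  { Y | ∃ Z ∈ BigCovectors C, ∀ i, Y i = Z (Sum.inl i) }

/-- There is a chain of `r+1` distinct covectors in the conformal order. -/
def HasChain {E : Type*} (C : Set (E → SignType)) (r : ℕ) : Prop :=
  ∃ c : Fin (r + 1) → (E → SignType), (∀ i, c i ∈ C) ∧
    ∀ i j : Fin (r + 1), i < j → covLE (c i) (c j) ∧ c i ≠ c j

/-- The set of covectors has rank `r`: maximal chains in the poset of covectors have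
length `r`. -/
def HasRank {E : Type*} (C : Set (E → SignType)) (r : ℕ) : Prop :=
  HasChain C r ∧ ¬ HasChain C (r + 1)

/-- Restriction of a set of covectors to a subset `F` of the ground set. -/
def restrictSet {E : Type*} (C : Set (E → SignType)) (F : Set E) : Set (F → SignType) :=
  { Y | ∃ X ∈ C, ∀ e : F, Y e = X e.1 }

/-- A flat of an oriented matroid: the zero set of a covector. -/
def IsFlat {E : Type*} (C : Set (E → SignType)) (F : Set E) : Prop :=
  ∃ X ∈ C, F = {e | X e = 0}

namespace NonSweepable

/-! ### Oriented matroids from face separation -/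

section Axioms

variable {E : Type*} {C : Set (E → SignType)}

/-- Every two distinct covectors `X`, `Y` with the same support are separated by a face of `X`
all of whose new zeros lie in the separator of `X` and `Y`. -/
def HasSeparatingFaces (C : Set (E → SignType)) : Prop :=
  ∀ X ∈ C, ∀ Y ∈ C, (∀ e, X e = 0 ↔ Y e = 0) → X ≠ Y →
    ∃ Z ∈ C, Z ≠ X ∧ (∀ e, Z e = 0 ∨ Z e = X e) ∧ ∀ e, Z e = 0 → X e ≠ 0 → Y e = -X e

theorem HasSeparatingFaces.elim_of_same_support [Fintype E]
    (hC : HasSeparatingFaces C) (hcomp : ∀ X ∈ C, ∀ Y ∈ C, signComp X Y ∈ C)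
    {X Y : E → SignType} (hX : X ∈ C) (hY : Y ∈ C) (hXY : ∀ e, X e = 0 ↔ Y e = 0)
    {e : E} (he : X e ≠ 0) (he' : X e = -Y e) :
    ∃ Z ∈ C, Z e = 0 ∧ ∀ f, ¬(X f ≠ 0 ∧ X f = -Y f) → Z f = X f := by
  classical
  induction hn : (Finset.univ.filter fun f => X f ≠ Y f).card using Nat.strong_induction_on
    generalizing X with
  | _ m ih =>
    have hne : X ≠ Y := by
      rintro rfl
      revert he he'
      generalize X e = x
      revert x
      decide
    obtain ⟨Z, hZ, hZX, hle, hsep⟩ := hC X hX Y hY hXY hne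
    by_cases hZe : Z e = 0
    · refine ⟨Z, hZ, hZe, fun f hf => (hle f).elim (fun h0 => ?_) id⟩
      by_contra hcon
      have hXf : X f ≠ 0 := fun h => hcon (h0.trans h.symm)
      exact hf ⟨hXf, by rw [hsep f h0 hXf, neg_neg]⟩
    · have hZe' : Z e = X e := (hle e).resolve_left hZe
      have hval : ∀ f, Z f ≠ 0 → signComp Z Y f = X f := fun f hf => by
        rw [← (hle f).resolve_left hf]
        simp [signComp, hf]
      have hval0 : ∀ f, Z f = 0 → signComp Z Y f = Y f := fun f hf => by simp [signComp, hf]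
      have hcard : (Finset.univ.filter fun f => signComp Z Y f ≠ Y f).card < m := by
        rw [← hn]
        apply Finset.card_lt_card
        rw [Finset.ssubset_iff_of_subset]
        · obtain ⟨f, hf⟩ := Function.ne_iff.mp hZX
          have hf0 := (hle f).resolve_right hf
          have hXf : X f ≠ 0 := fun h => hf (hf0.trans h.symm)
          refine ⟨f, ?_, by simp [hval0 f hf0]⟩
          simp only [Finset.mem_filter, Finset.mem_univ, true_and, hsep f hf0 hXf]
          revert hXf
          generalize X f = x
          revert x
          decide
        · intro f hf
          simp only [Finset.mem_filter, Finset.mem_univ, true_and] at hf ⊢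
          by_cases hf0 : Z f = 0
          · exact absurd (hval0 f hf0) hf
          · rwa [hval f hf0] at hf
      obtain ⟨Z', hZ', hZ'e, hZ'f⟩ := ih _ hcard (X := signComp Z Y) (hcomp Z hZ Y hY)
        (fun f => by
          by_cases hf0 : Z f = 0
          · rw [hval0 f hf0]
          · rw [hval f hf0, hXY])
        (by rwa [hval e hZe]) (by rwa [hval e hZe]) rfl
      refine ⟨Z', hZ', hZ'e, fun f hf => ?_⟩
      have hcompf : signComp Z Y f = X f := by
        by_cases hf0 : Z f = 0
        · rw [hval0 f hf0]
          by_cases hXf : X f = 0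
          · rw [hXf, (hXY f).mp hXf]
          · exact absurd ⟨hXf, by rw [hsep f hf0 hXf, neg_neg]⟩ hf
        · exact hval f hf0
      rw [hZ'f f (by rwa [hcompf]), hcompf]

/-- The face separation property implies covector elimination. -/
theorem isOrientedMatroid_of_hasSeparatingFaces [Fintype E] (h0 : (fun _ => 0) ∈ C)
    (hneg : ∀ X ∈ C, -X ∈ C) (hcomp : ∀ X ∈ C, ∀ Y ∈ C, signComp X Y ∈ C)
    (hC : HasSeparatingFaces C) : IsOrientedMatroid C := by
  refine ⟨h0, hneg, hcomp, fun X hX Y hY e he he' => ?_⟩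
  have key : ∀ x y : SignType, ((if x = 0 then y else x) = 0 ↔ (if y = 0 then x else y) = 0) ∧
      (x ≠ 0 → x = -y → (if x = 0 then y else x) ≠ 0 ∧
        (if x = 0 then y else x) = -(if y = 0 then x else y)) ∧
      (¬(x ≠ 0 ∧ x = -y) → ¬((if x = 0 then y else x) ≠ 0 ∧
        (if x = 0 then y else x) = -(if y = 0 then x else y))) := by decide
  have hXY := (key (X e) (Y e)).2.1 he he'
  obtain ⟨Z, hZ, hZe, hZf⟩ := hC.elim_of_same_support hcomp (hcomp X hX Y hY) (hcomp Y hY X hX)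
    (fun f => (key (X f) (Y f)).1) hXY.1 hXY.2
  exact ⟨Z, hZ, hZe, fun f hf => hZf f ((key (X f) (Y f)).2.2 hf)⟩

/-- Replacing elements by parallel classes preserves the covector axioms. -/
theorem isOrientedMatroid_image_comp {F : Type*} (hC : IsOrientedMatroid C) (π : F → E) :
    IsOrientedMatroid ((fun X => X ∘ π) '' C) := by
  obtain ⟨h0, hneg, hcomp, helim⟩ := hC
  refine ⟨⟨_, h0, rfl⟩, ?_, ?_, ?_⟩
  · rintro _ ⟨X, hX, rfl⟩
    exact ⟨-X, hneg X hX, rfl⟩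
  · rintro _ ⟨X, hX, rfl⟩ _ ⟨Y, hY, rfl⟩
    exact ⟨_, hcomp X hX Y hY, rfl⟩
  · rintro _ ⟨X, hX, rfl⟩ _ ⟨Y, hY, rfl⟩ e he he'
    obtain ⟨Z, hZ, hZe, hZf⟩ := helim X hX Y hY (π e) he he'
    exact ⟨_, ⟨Z, hZ, rfl⟩, hZe, fun f hf => hZf (π f) hf⟩

/-- Orthogonality of sign vectors. -/
def Orthogonal (X c : E → SignType) : Prop :=
  (∃ e, X e ≠ 0 ∧ X e = c e) ↔ ∃ e, X e ≠ 0 ∧ X e = -c e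

theorem Orthogonal.neg {X c : E → SignType} (h : Orthogonal X c) : Orthogonal (-X) c := by
  simpa only [Orthogonal, Pi.neg_apply, ne_eq, neg_eq_iff_eq_neg, neg_neg, neg_zero] using h.symm

theorem Orthogonal.signComp {X Y c : E → SignType} (hX : Orthogonal X c) (hY : Orthogonal Y c) :
    Orthogonal (signComp X Y) c := by
  have lift : ∀ e, X e ≠ 0 → _root_.signComp X Y e = X e := fun e he => by
    simp [_root_.signComp, he]
  by_cases h : ∃ e, X e ≠ 0 ∧ X e = c e
  · obtain ⟨e', he', hc'⟩ := hX.mp h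
    obtain ⟨e, he, hc⟩ := h
    exact iff_of_true ⟨e, by rw [lift e he]; exact ⟨he, hc⟩⟩
      ⟨e', by rw [lift e' he']; exact ⟨he', hc'⟩⟩
  · have h' : ¬∃ e, X e ≠ 0 ∧ X e = -c e := fun h' => h (hX.mpr h')
    push Not at h h'
    have key : ∀ x y d : SignType, (x ≠ 0 → x ≠ d) → (x ≠ 0 → x ≠ -d) →
        (((if x = 0 then y else x) ≠ 0 ∧ (if x = 0 then y else x) = d ↔ y ≠ 0 ∧ y = d) ∧
        ((if x = 0 then y else x) ≠ 0 ∧ (if x = 0 then y else x) = -d ↔ y ≠ 0 ∧ y = -d)) := by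
      decide
    have hk := fun e => key (X e) (Y e) (c e) (h e) (h' e)
    exact (exists_congr fun e => (hk e).1).trans (hY.trans (exists_congr fun e => (hk e).2).symm)

end Axioms

/-! ### Sweeps and elimination in the big oriented matroid -/

section Sweeps

open SignType

variable {n : ℕ} {M : Set (Pairs n → SignType)}

/-- Integer-valued functions on `[n]` inducing an ordered partition whose
sign vector is a covector of `M`. -/
def sweeps (M : Set (Pairs n → SignType)) : Set (Fin n → ℤ) :=
  {p | ∃ X ∈ M, ∀ e : Pairs n, X e = sign (p e.1.2 - p e.1.1)}

/-- `r` is the order refining `p` by `q`. -/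
def IsRefinement (p q r : Fin n → ℤ) : Prop :=
  ∀ a b, (p a < p b → r a < r b) ∧
    (p a = p b → (q a < q b → r a < r b) ∧ (q a = q b → r a = r b))

/-- `r` agrees with the comparisons on which `p` and `q` do not conflict. -/
def IsBetween (p q r : Fin n → ℤ) : Prop :=
  ∀ a b, p a ≤ p b → q a ≤ q b → r a ≤ r b ∧ (p a < p b ∨ q a < q b → r a < r b)

theorem sign_sub_eq_ite (a b : ℤ) :
    sign (b - a) = if a < b then 1 else if b < a then -1 else 0 := by
  rcases lt_trichotomy a b with h | rfl | h
  · simp [h]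
  · simp
  · simp [h, h.not_gt]

theorem exists_sweep_of_mem (hbraid : ∀ X ∈ M, IsBraidCovector X) {X : Pairs n → SignType}
    (hX : X ∈ M) : ∃ p ∈ sweeps M, ∀ e : Pairs n, X e = sign (p e.1.2 - p e.1.1) := by
  obtain ⟨l, p, -, hp⟩ := hbraid X hX
  have h : ∀ e : Pairs n, X e = sign (((p e.1.2 : ℕ) : ℤ) - ((p e.1.1 : ℕ) : ℤ)) := fun e => by
    rw [hp, sign_sub_eq_ite]
    simp only [Nat.cast_lt, Fin.val_fin_lt]
  exact ⟨fun i => ((p i : ℕ) : ℤ), ⟨X, hX, h⟩, h⟩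

theorem neg_mem_sweeps (hM : IsOrientedMatroid M) {p : Fin n → ℤ} (hp : p ∈ sweeps M) :
    -p ∈ sweeps M := by
  obtain ⟨X, hX, h⟩ := hp
  refine ⟨-X, hM.2.1 X hX, fun e => ?_⟩
  rw [Pi.neg_apply, h, ← Left.sign_neg]
  congr 1
  simp only [Pi.neg_apply]
  ring

theorem refine_of_sign_eq {x y z : ℤ}
    (h : sign z = if sign x = 0 then sign y else sign x) :
    (0 < x → 0 < z) ∧ (x < 0 → z < 0) ∧
      (x = 0 → (0 < y → 0 < z) ∧ (y < 0 → z < 0) ∧ (y = 0 → z = 0)) := by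
  rcases lt_trichotomy x 0 with hx | hx | hx <;> rcases lt_trichotomy y 0 with hy | hy | hy <;>
    rcases lt_trichotomy z 0 with hz | hz | hz <;>
    simp_all [sign_pos, sign_neg] <;> omega

theorem exists_refinement (hM : IsOrientedMatroid M) (hbraid : ∀ X ∈ M, IsBraidCovector X)
    {p q : Fin n → ℤ} (hp : p ∈ sweeps M) (hq : q ∈ sweeps M) :
    ∃ r ∈ sweeps M, IsRefinement p q r := by
  obtain ⟨X, hX, hXp⟩ := hp
  obtain ⟨Y, hY, hYq⟩ := hq
  obtain ⟨r, hr, hrs⟩ := exists_sweep_of_mem hbraid (hM.2.2.1 X hX Y hY)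
  refine ⟨r, hr, fun a b => ?_⟩
  rcases lt_trichotomy a b with hab | rfl | hab
  · have h := hrs ⟨(a, b), hab⟩
    simp only [signComp, hXp, hYq] at h
    have := refine_of_sign_eq h.symm
    omega
  · simp
  · have h := hrs ⟨(b, a), hab⟩
    simp only [signComp, hXp, hYq] at h
    have := refine_of_sign_eq h.symm
    omega

theorem between_of_sign_eq {x y z : ℤ}
    (h : ¬(sign x ≠ 0 ∧ sign x = -sign y) → sign z = if sign x = 0 then sign y else sign x) :
    (0 ≤ x → 0 ≤ y → 0 ≤ z ∧ (0 < x ∨ 0 < y → 0 < z)) ∧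
      (x ≤ 0 → y ≤ 0 → z ≤ 0 ∧ (x < 0 ∨ y < 0 → z < 0)) := by
  rcases lt_trichotomy x 0 with hx | hx | hx <;> rcases lt_trichotomy y 0 with hy | hy | hy <;>
    rcases lt_trichotomy z 0 with hz | hz | hz <;>
    simp_all [sign_pos, sign_neg] <;> omega

theorem exists_between (hM : IsOrientedMatroid M) (hbraid : ∀ X ∈ M, IsBraidCovector X)
    {p q : Fin n → ℤ} (hp : p ∈ sweeps M) (hq : q ∈ sweeps M) {i j : Fin n}
    (hpij : p i < p j) (hqij : q j < q i) :
    ∃ r ∈ sweeps M, r i = r j ∧ IsBetween p q r := by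
  obtain ⟨X, hX, hXp⟩ := hp
  obtain ⟨Y, hY, hYq⟩ := hq
  have main : ∀ e : Pairs n, X e ≠ 0 → X e = -Y e →
      ∃ r ∈ sweeps M, r e.1.1 = r e.1.2 ∧ IsBetween p q r := by
    intro e he he'
    obtain ⟨Z, hZ, hZe, hZf⟩ := hM.2.2.2 X hX Y hY e he he'
    obtain ⟨r, hr, hrs⟩ := exists_sweep_of_mem hbraid hZ
    refine ⟨r, hr, ?_, fun a b => ?_⟩
    · have := hrs e
      rw [hZe, eq_comm, sign_eq_zero_iff] at this
      omega
    · rcases lt_trichotomy a b with hab | rfl | hab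
      · have h := hZf ⟨(a, b), hab⟩
        simp only [signComp, hrs, hXp, hYq] at h
        have := between_of_sign_eq h
        omega
      · simp
      · have h := hZf ⟨(b, a), hab⟩
        simp only [signComp, hrs, hXp, hYq] at h
        have := between_of_sign_eq h
        omega
  rcases lt_trichotomy i j with hij | rfl | hij
  · refine main ⟨(i, j), hij⟩ ?_ ?_
    · simp [hXp, sign_pos (sub_pos.mpr hpij)]
    · simp [hXp, hYq, sign_pos (sub_pos.mpr hpij), sign_neg (sub_neg.mpr hqij)]
  · exact absurd hpij (lt_irrefl _)
  · obtain ⟨r, hr, hrij, hbt⟩ := main ⟨(j, i), hij⟩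
      (by simp [hXp, sign_neg (sub_neg.mpr hpij)])
      (by simp [hXp, hYq, sign_pos (sub_pos.mpr hqij), sign_neg (sub_neg.mpr hpij)])
    exact ⟨r, hr, hrij.symm, hbt⟩

/-- Covector elimination of the big oriented matroid at an element of `[n]`: the covectors
given by `p` with cut `c` and `q` with cut `d` are eliminated at `i`. -/
theorem exists_between_of_cuts (hM : IsOrientedMatroid M) (hbraid : ∀ X ∈ M, IsBraidCovector X)
    {p q : Fin n → ℤ} (hp : p ∈ sweeps M) (hq : q ∈ sweeps M) {c d : ℤ} {i : Fin n}
    (hpi : c < p i) (hqi : q i < d) :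
    ∃ r ∈ sweeps M, IsBetween p q r ∧
      ∀ j, (c ≤ p j → d ≤ q j → r i ≤ r j ∧ (c < p j ∨ d < q j → r i < r j)) ∧
        (p j ≤ c → q j ≤ d → r j ≤ r i ∧ (p j < c ∨ q j < d → r j < r i)) := by
  by_cases h0 : ∃ j, p j = c ∧ q j = d
  · obtain ⟨j₀, hpj, hqj⟩ := h0
    obtain ⟨r, hr, hrj, hbt⟩ := exists_between hM hbraid hp hq (i := j₀) (j := i)
      (by omega) (by omega)
    refine ⟨r, hr, hbt, fun j => ?_⟩
    have h₁ := hbt j₀ j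
    have h₂ := hbt j j₀
    omega
  · push Not at h0
    obtain ⟨s, hs, hps⟩ := exists_refinement hM hbraid hp hq
    suffices h : ∀ S : Finset (Fin n), (∀ j ∈ S, p j ≤ c ∧ q j ≤ d) →
        ∃ r ∈ sweeps M, IsBetween p q r ∧ (∀ j, c ≤ p j → d ≤ q j → r i < r j) ∧
          ∀ j ∈ S, r j < r i by
      obtain ⟨r, hr, hbt, hup, hdown⟩ := h (Finset.univ.filter fun j => p j ≤ c ∧ q j ≤ d)
        (fun j hj => (Finset.mem_filter.mp hj).2)
      refine ⟨r, hr, hbt, fun j => ⟨fun h₁ h₂ => ?_, fun h₁ h₂ => ?_⟩⟩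
      · have := hup j h₁ h₂
        omega
      · have := hdown j (by simp [h₁, h₂])
        omega
    intro S
    induction S using Finset.induction_on with
    | empty =>
      intro _
      obtain ⟨r, hr, hqr⟩ := exists_refinement hM hbraid hq hp
      refine ⟨r, hr, fun a b => ?_, fun j h₁ h₂ => (hqr i j).1 (by omega), by simp⟩
      have := hqr a b
      omega
    | insert j S _ ih =>
      intro hS
      obtain ⟨r, hr, hbt, hup, hdown⟩ := ih fun k hk => hS k (Finset.mem_insert_of_mem hk)
      obtain ⟨hpj, hqj⟩ := hS j (Finset.mem_insert_self j S)
      -- It suffices to push `j` to the level of `i`; refining by `s` then makes it strict.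
      suffices h : ∃ r ∈ sweeps M, IsBetween p q r ∧ (∀ k, c ≤ p k → d ≤ q k → r i < r k) ∧
          (∀ k ∈ S, r k < r i) ∧ r j ≤ r i by
        obtain ⟨r, hr, hbt, hup, hdown, hj⟩ := h
        obtain ⟨t, ht, hrt⟩ := exists_refinement hM hbraid hr hs
        refine ⟨t, ht, fun a b => ?_, fun k h₁ h₂ => (hrt i k).1 (hup k h₁ h₂), fun k hk => ?_⟩
        · have h₁ := hbt a b
          have h₂ := hrt a b
          have h₃ := hps a b
          omega
        · rcases Finset.mem_insert.mp hk with rfl | hk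
          · have h₂ := hrt k i
            have h₃ := hps k i
            omega
          · exact (hrt k i).1 (hdown k hk)
      rcases le_or_gt (r j) (r i) with hj | hj
      · exact ⟨r, hr, hbt, hup, hdown, hj⟩
      · have hsj : s j < s i := (hps j i).1 (by omega)
        obtain ⟨t, ht, htij, hrt⟩ := exists_between hM hbraid hr hs hj hsj
        refine ⟨t, ht, fun a b => ?_, fun k h₁ h₂ => ?_, fun k hk => ?_, htij.ge⟩
        · have h₁ := hbt a b
          have h₂ := hrt a b
          have h₃ := hps a b
          omega
        · have h₁ := hbt j k
          have h₂ := hrt j k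
          have h₃ := hps j k
          have h₄ := h0 k
          have h₅ := h0 j
          omega
        · have h₁ := hdown k hk
          have h₂ := (hps k i).1
          have h₃ := hS k (Finset.mem_insert_of_mem hk)
          have h₄ := hrt k i
          omega

/-- Cutting a sweep at the level of an element gives a covector of the little oriented
matroid. -/
theorem cut_mem_littleCovectors (hbraid : ∀ X ∈ M, IsBraidCovector X) {r : Fin n → ℤ}
    (hr : r ∈ sweeps M) (i : Fin n) : (fun j => sign (r j - r i)) ∈ LittleCovectors M := by
  obtain ⟨X, hX, hXr⟩ := hr
  obtain ⟨l, p, hsurj, hp⟩ := hbraid X hX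
  have hlt : ∀ a b : Fin n, (p a < p b ↔ r a < r b) ∧ (p b < p a ↔ r b < r a) := by
    have main : ∀ a b : Fin n, a < b → (p a < p b ↔ r a < r b) ∧ (p b < p a ↔ r b < r a) := by
      intro a b hab
      have h := hXr ⟨(a, b), hab⟩
      rw [hp] at h
      simp only [sign_sub_eq_ite] at h
      split_ifs at h <;> simp_all <;> omega
    intro a b
    rcases lt_trichotomy a b with hab | rfl | hab
    · exact main a b hab
    · simp
    · exact (main b a hab).symm
  refine ⟨Sum.elim (fun j => sign (r j - r i)) X, ⟨X, hX, l, p, hsurj, hp, 2 * (p i + 1),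
    by omega, by omega, fun j => ?_, fun _ => rfl⟩, fun _ => rfl⟩
  have h := hlt i j
  simp only [Sum.elim_inl, sign_sub_eq_ite, Fin.lt_def] at h ⊢
  split_ifs <;> first | rfl | omega

/-- Every covector of the little oriented matroid is a cut of a sweep. -/
theorem exists_cut_of_mem_littleCovectors {Y : Fin n → SignType} (hY : Y ∈ LittleCovectors M) :
    ∃ p ∈ sweeps M, ∃ c : ℤ, ∀ i, Y i = sign (p i - c) := by
  obtain ⟨Z, ⟨X, hX, l, p, -, hp, k, -, -, hZ, -⟩, hYZ⟩ := hY
  refine ⟨fun i => 2 * ((p i : ℕ) : ℤ) + 2, ⟨X, hX, fun e => ?_⟩, k, fun i => ?_⟩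
  · rw [hp, sign_sub_eq_ite]
    simp only [Fin.lt_def]
    split_ifs <;> first | rfl | omega
  · rw [hYZ, hZ, sign_sub_eq_ite]
    dsimp only
    split_ifs <;> first | rfl | omega

/-- `Y` is the restriction to `[n]` of a covector of the big oriented matroid with sign `s` on
the pair `(f, g)`. -/
def Lifts (M : Set (Pairs n → SignType)) (f g : Fin n) (Y : Fin n → SignType) (s : SignType) :
    Prop :=
  Y ∈ LittleCovectors M ∧
    ∃ p ∈ sweeps M, ∃ c : ℤ, (∀ j, Y j = sign (p j - c)) ∧ s = sign (p g - p f)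

variable {f g : Fin n} {Y Y' : Fin n → SignType} {s t : SignType}

theorem exists_lifts (hY : Y ∈ LittleCovectors M) : ∃ s, Lifts M f g Y s := by
  obtain ⟨p, hp, c, h⟩ := exists_cut_of_mem_littleCovectors hY
  exact ⟨_, hY, p, hp, c, h, rfl⟩

theorem Lifts.neg (hM : IsOrientedMatroid M) (hL : -Y ∈ LittleCovectors M)
    (h : Lifts M f g Y s) : Lifts M f g (-Y) (-s) := by
  obtain ⟨-, p, hp, c, hY, hs⟩ := h
  refine ⟨hL, -p, neg_mem_sweeps hM hp, -c, fun j => ?_, ?_⟩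
  · rw [Pi.neg_apply, hY, ← Left.sign_neg]
    congr 1
    simp only [Pi.neg_apply]
    ring
  · rw [hs, ← Left.sign_neg]
    congr 1
    simp only [Pi.neg_apply]
    ring

theorem Lifts.eq_zero (h : Lifts M f g (fun _ => 0) s) : s = 0 := by
  obtain ⟨-, p, -, c, hY, hs⟩ := h
  have hf := (sign_eq_zero_iff.mp (hY f).symm)
  have hg := (sign_eq_zero_iff.mp (hY g).symm)
  rw [hs, sign_eq_zero_iff]
  omega

theorem Lifts.eq_neg_one (h : Lifts M f g Y s) (hf : Y f = 1) (hg : Y g = 0) : s = -1 := by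
  obtain ⟨-, p, -, c, hY, hs⟩ := h
  have hf := (sign_eq_one_iff.mp ((hY f).symm.trans hf))
  have hg := (sign_eq_zero_iff.mp ((hY g).symm.trans hg))
  rw [hs, sign_eq_neg_one_iff]
  omega

theorem Lifts.eq_one (h : Lifts M f g Y s) (hf : Y f = 0) (hg : Y g = 1) : s = 1 := by
  obtain ⟨-, p, -, c, hY, hs⟩ := h
  have hf := (sign_eq_zero_iff.mp ((hY f).symm.trans hf))
  have hg := (sign_eq_one_iff.mp ((hY g).symm.trans hg))
  rw [hs, sign_eq_one_iff]
  omega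

/-- The tope in which all elements lie above the cut lifts to a covector vanishing on all
pairs. -/
theorem lifts_one_zero (hM : IsOrientedMatroid M)
    (h : (fun _ => (1 : SignType)) ∈ LittleCovectors M) : Lifts M f g (fun _ => 1) 0 :=
  ⟨h, 0, ⟨_, hM.1, fun _ => by simp⟩, -1, fun _ => by simp, by simp⟩

theorem sign_sub_eq_ite_of_between {a b x y z : ℤ}
    (h₁ : a ≤ b → x ≤ y → 0 ≤ z ∧ (a < b ∨ x < y → 0 < z))
    (h₂ : b ≤ a → y ≤ x → z ≤ 0 ∧ (b < a ∨ y < x → z < 0))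
    (h : ¬(sign (b - a) ≠ 0 ∧ sign (b - a) = -sign (y - x))) :
    sign z = if sign (b - a) = 0 then sign (y - x) else sign (b - a) := by
  simp only [sign_sub_eq_ite] at h ⊢
  rw [← sub_zero z, sign_sub_eq_ite]
  split_ifs at h ⊢ <;> first | rfl | omega | simp_all

theorem Lifts.elim (hM : IsOrientedMatroid M) (hbraid : ∀ X ∈ M, IsBraidCovector X)
    (hY : Lifts M f g Y s) (hY' : Lifts M f g Y' t) {i : Fin n} (hi : Y i ≠ 0)
    (hi' : Y i = -Y' i) :
    ∃ Z u, Lifts M f g Z u ∧ Z i = 0 ∧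
      (∀ j, ¬(Y j ≠ 0 ∧ Y j = -Y' j) → Z j = signComp Y Y' j) ∧
      (¬(s ≠ 0 ∧ s = -t) → u = if s = 0 then t else s) := by
  wlog hpos : Y i = 1 generalizing Y Y' s t
  · have key : ∀ x y : SignType, (x ≠ 0 → x = -y → x ≠ 1 → y ≠ 0 ∧ y = -x ∧ y = 1) ∧
        (¬(x ≠ 0 ∧ x = -y) → ¬(y ≠ 0 ∧ y = -x) ∧
          (if y = 0 then x else y) = if x = 0 then y else x) := by decide
    obtain ⟨h₁, h₂, h₃⟩ := (key (Y i) (Y' i)).1 hi hi' hpos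
    obtain ⟨Z, u, hZ, hZi, hZj, hu⟩ := this hY' hY h₁ h₂ h₃
    exact ⟨Z, u, hZ, hZi,
      fun j hj => (hZj j ((key _ _).2 hj).1).trans ((key _ _).2 hj).2,
      fun h => (hu ((key _ _).2 h).1).trans ((key _ _).2 h).2⟩
  · obtain ⟨-, p, hp, c, hYp, rfl⟩ := hY
    obtain ⟨-, q, hq, d, hYq, rfl⟩ := hY'
    have hpi : c < p i := by
      rw [hYp, sign_eq_one_iff] at hpos
      omega
    have hqi : q i < d := by
      rw [hpos, eq_comm, neg_eq_iff_eq_neg, hYq, sign_eq_neg_one_iff] at hi'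
      omega
    obtain ⟨r, hr, hbt, hcut⟩ := exists_between_of_cuts hM hbraid hp hq hpi hqi
    refine ⟨_, _, ⟨cut_mem_littleCovectors hbraid hr i, r, hr, r i, fun _ => rfl, rfl⟩, by simp,
      fun j hj => ?_, fun h => ?_⟩
    · rw [hYp, hYq] at hj
      have := hcut j
      simp only [signComp, hYp, hYq]
      exact sign_sub_eq_ite_of_between (by omega) (by omega) hj
    · have h₁ := hbt f g
      have h₂ := hbt g f
      exact sign_sub_eq_ite_of_between (by omega) (by omega) h

end Sweeps

/-! ### A non-Euclidean oriented matroid of rank four on eight elements -/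

section Code

/-- A sign vector is coded by a bit mask: bit `i` marks a positive and bit `i + 8` a negative
entry at `i`. -/
def bitSign (x i : ℕ) : SignType :=
  if x.testBit i then 1 else if x.testBit (i + 8) then -1 else 0

/-- The sign vector coded by `x`. -/
def decode (x : ℕ) (i : Fin 8) : SignType := bitSign x i

/-- The pairs of opposite circuits of the eight-element oriented matroid, as bit masks. -/
def circuits : List (ℕ × ℕ) :=
  [(1561, 6406), (9737, 2342), (19969, 334), (653, 36098), (13825, 310), (17937, 4422),
    (33811, 4996), (26113, 358), (42497, 422), (17029, 34114), (569, 14594), (601, 22786),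
    (665, 39170), (18467, 9032), (8841, 35106), (19073, 33098), (16435, 13120), (32819, 13184),
    (17041, 37186), (25217, 33122), (15361, 316), (23553, 348), (33817, 6532), (19489, 8524),
    (44033, 428), (52225, 460), (17457, 12612), (42001, 4516), (50193, 4548), (16549, 42304),
    (16441, 14656), (32825, 14720), (32857, 22912), (18593, 41288), (16561, 45376), (15362, 572),
    (23554, 604), (35858, 4748), (18470, 9800), (44034, 684), (52226, 716), (16438, 13888),
    (32822, 13952), (33874, 21124), (16550, 42560), (22562, 8792), (34866, 12936), (32858, 23168),
    (51234, 8904), (32882, 29312), (16444, 15424), (32828, 15488), (32860, 23680), (16556, 44096),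
    (20644, 42064), (41048, 22688)]

/-- The covectors of the eight-element oriented matroid. -/
def covectors : Set (Fin 8 → SignType) := {X | ∀ c ∈ circuits, Orthogonal X (decode c.1)}

/-- Codes of all sign vectors supported on the first `k` elements. -/
def codes : ℕ → List ℕ
  | 0 => [0]
  | k + 1 => (codes k).flatMap fun x => [x, x ||| 2 ^ k, x ||| 2 ^ (k + 8)]

def isCode (x : ℕ) : Bool :=
  Nat.blt x 65536 && Nat.beq (Nat.land x (Nat.shiftRight x 8)) 0

def isCovectorCode (x : ℕ) : Bool :=
  isCode x && circuits.all fun c =>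
    cond (Nat.beq (Nat.land x c.1) 0) (Nat.beq (Nat.land x c.2) 0)
      (!Nat.beq (Nat.land x c.2) 0)

def covectorCodes : List ℕ := (codes 8).filter isCovectorCode

/-- `force n f = f n`, but kernel reduction evaluates `n` to a literal first. -/
def force (n : ℕ) (f : ℕ → Bool) : Bool :=
  match n with
  | 0 => f 0
  | i + 1 => f (i + 1)

/-- Evaluate `k` at the reversed list of those elements of `l` satisfying `p`. -/
def withFilter (p : ℕ → Bool) (k : List ℕ → Bool) : List ℕ → List ℕ → Bool
  | [], acc => k acc
  | x :: l, acc => force x fun x =>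
      cond (p x) (withFilter p k l (x :: acc)) (withFilter p k l acc)

/-- The nonzero entries of `x` whose erasure leaves a covector. -/
def facetMask (x : ℕ) : ℕ → ℕ
  | 0 => 0
  | j + 1 => cond (Nat.beq (Nat.land x (2 ^ j)) 0) (facetMask x j)
      (cond (force (Nat.xor x (2 ^ j)) isCovectorCode) (Nat.lor (2 ^ j) (facetMask x j))
        (facetMask x j))

/-- The face separation property for `x` and the opposite of `z`. -/
def separated (F x z : ℕ) : Bool :=
  cond (Nat.beq (Nat.land F z) 0) (Nat.beq z x || Nat.beq (Nat.land x z) 0) true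

def checkSameSupport (G : List ℕ) : Bool :=
  G.all fun x => force (facetMask x 16) fun F => G.all fun z => separated F x z

def vanishes (i x : ℕ) : Bool := Nat.beq (Nat.land x (Nat.lor (2 ^ i) (2 ^ (i + 8)))) 0

/-- Split `G` by supports on the first `k` elements and check every part. -/
def checkFaces : ℕ → List ℕ → Bool
  | 0, G => checkSameSupport G
  | i + 1, G => withFilter (vanishes i) (checkFaces i) G [] &&
      withFilter (fun x => !vanishes i x) (checkFaces i) G []

/-- Whether `x` codes the zero vector or a sign vector with at most three zeros. -/
def hasFewZeros (x : ℕ) : Bool :=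
  Nat.beq x 0 || Nat.ble ((List.finRange 8).filter fun e : Fin 8 => vanishes e x).length 3

/-- Quadruples `(x, y, e, z)` such that eliminating `e` from the covectors coded by `x` and `y`
yields the covector coded by `z`; here `y` is positive at `0` and vanishes at `1`. -/
def descents : List (ℕ × ℕ × ℕ × ℕ) :=
  [(227, 57349, 5, 199), (199, 57349, 6, 8327), (8327, 43013, 7, 10247), (10247, 5161, 2, 12299),
    (12299, 6241, 5, 4171), (4171, 2257, 4, 203), (203, 2257, 3, 211), (211, 36961, 4, 227)]

/-- Further such quadruples, where `y` vanishes at `0` and is positive at `1`. -/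
def ascents : List (ℕ × ℕ × ℕ × ℕ) :=
  [(227, 24722, 5, 211), (211, 53258, 4, 203), (203, 53258, 7, 4171), (4171, 28682, 6, 12299),
    (12299, 10262, 4, 10247), (10247, 9354, 3, 8327), (8327, 1250, 5, 199)]

/-- Further such quadruples, where `y` is the opposite of a vertex of the positive tope. -/
def closings : List (ℕ × ℕ × ℕ × ℕ) :=
  [(255, 58112, 5, 223), (223, 54016, 4, 207), (207, 51968, 3, 199), (199, 50944, 2, 0)]

def eliminations : List (ℕ × ℕ × ℕ × ℕ) := descents ++ ascents ++ closings

/-- Both bits of every element outside the separator of `x` and `y`. -/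
def agreementMask (x y : ℕ) : ℕ :=
  Nat.xor 65535 (257 * Nat.land (Nat.lor x y) ((Nat.lor x y) / 256 % 256))

/-- Whether `z` is the only code among `G` that can result from eliminating `e` from `x` and `y`. -/
def checkElimination (G : List ℕ) (x y e z : ℕ) : Bool :=
  force (Nat.lor (agreementMask x y) (257 * 2 ^ e)) fun mask =>
    force (Nat.land (Nat.lor x y) (agreementMask x y)) fun value =>
      G.all fun w => cond (Nat.beq (Nat.land w mask) value) (Nat.beq w z) true

def checkEliminations (G : List ℕ) : Bool :=
  eliminations.all fun q => checkElimination G q.1 q.2.1 q.2.2.1 q.2.2.2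

def checkCovectors (G : List ℕ) : Bool :=
  checkFaces 8 G && G.all hasFewZeros && checkEliminations G

theorem force_eq (n : ℕ) (f : ℕ → Bool) : force n f = f n := by cases n <;> rfl

theorem withFilter_eq (p : ℕ → Bool) (k : List ℕ → Bool) (l acc : List ℕ) :
    withFilter p k l acc = k ((l.filter p).reverse ++ acc) := by
  induction l generalizing acc with
  | nil => rfl
  | cons x l ih => cases h : p x <;> simp [withFilter, force_eq, ih, h]

theorem isCode_iff {x : ℕ} :
    isCode x ↔ x < 2 ^ 16 ∧ ∀ i, x.testBit i → x.testBit (i + 8) → False := by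
  rw [isCode, Bool.and_eq_true, Nat.blt_eq, Nat.beq_eq]
  refine and_congr Iff.rfl ⟨fun h i h₁ h₂ => ?_, fun h => Nat.eq_of_testBit_eq fun i => ?_⟩
  · have := congrArg (·.testBit i) h
    change (x &&& x >>> 8).testBit i = _ at this
    simp [Nat.testBit_and, Nat.testBit_shiftRight, h₁, Nat.add_comm 8 i, h₂] at this
  · change (x &&& x >>> 8).testBit i = _
    have := h i
    simp only [Nat.testBit_and, Nat.testBit_shiftRight, Nat.add_comm 8 i, Nat.zero_testBit]
    grind

theorem lt_of_testBit {x i : ℕ} (hx : isCode x) (hi : x.testBit i) : i < 16 := by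
  by_contra! h
  have := Nat.testBit_lt_two_pow
    ((isCode_iff.mp hx).1.trans_le (Nat.pow_le_pow_right two_pos h))
  simp_all

theorem decode_eq_one {x : ℕ} {e : Fin 8} : decode x e = 1 ↔ x.testBit e := by
  rw [decode, bitSign]
  split_ifs <;> simp_all

theorem decode_eq_neg_one {x : ℕ} (hx : isCode x) {e : Fin 8} :
    decode x e = -1 ↔ x.testBit (e + 8) := by
  have := (isCode_iff.mp hx).2 e
  rw [decode, bitSign]
  split_ifs <;> simp_all

theorem decode_eq_zero {x : ℕ} {e : Fin 8} :
    decode x e = 0 ↔ ¬x.testBit e ∧ ¬x.testBit (e + 8) := by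
  rw [decode, bitSign]
  split_ifs <;> simp_all

/-- The element carrying a given bit. -/
def bitElement (j : ℕ) : Fin 8 := ⟨j % 8, Nat.mod_lt _ (by norm_num)⟩

theorem eq_or_eq_bitElement {j : ℕ} (hj : j < 16) : j = bitElement j ∨ j = bitElement j + 8 := by
  simp only [bitElement]
  omega

theorem decode_eq_of_testBit {x z j : ℕ} (hx : isCode x) (hz : isCode z) (hxj : x.testBit j)
    (hzj : z.testBit j) :
    decode x (bitElement j) ≠ 0 ∧ decode x (bitElement j) = decode z (bitElement j) := by
  rcases eq_or_eq_bitElement (lt_of_testBit hx hxj) with h | h <;> rw [h] at hxj hzj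
  · simp [decode_eq_one.mpr hxj, decode_eq_one.mpr hzj]
  · simp [(decode_eq_neg_one hx).mpr hxj, (decode_eq_neg_one hz).mpr hzj]

theorem exists_testBit_of_ne_zero {x : ℕ} (hx : x ≠ 0) : ∃ j, x.testBit j := by
  by_contra! h
  exact hx (Nat.eq_of_testBit_eq fun i => by simpa using h i)

theorem land_ne_zero {x z : ℕ} (hx : isCode x) (hz : isCode z) :
    Nat.land x z ≠ 0 ↔ ∃ e, decode x e ≠ 0 ∧ decode x e = decode z e := by
  constructor
  · intro h
    obtain ⟨j, hj⟩ := exists_testBit_of_ne_zero h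
    change (x &&& z).testBit j at hj
    rw [Nat.testBit_and, Bool.and_eq_true] at hj
    exact ⟨_, decode_eq_of_testBit hx hz hj.1 hj.2⟩
  · rintro ⟨e, he, heq⟩ h
    have hbit : ∀ j, ¬(x.testBit j ∧ z.testBit j) := fun j hj => by
      have := congrArg (·.testBit j) h
      change (x &&& z).testBit j = _ at this
      simp [Nat.testBit_and, hj] at this
    rcases SignType.trichotomy (decode x e) with h' | h' | h'
    · exact hbit _ ⟨(decode_eq_neg_one hx).mp h', (decode_eq_neg_one hz).mp (heq ▸ h')⟩
    · exact he h'
    · exact hbit _ ⟨decode_eq_one.mp h', decode_eq_one.mp (heq ▸ h')⟩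

theorem isCode_of_mem_circuits : ∀ c ∈ circuits, isCode c.1 ∧ isCode c.2 ∧
    ∀ e, decode c.2 e = -decode c.1 e := by decide +kernel

theorem isCovectorCode_iff {x : ℕ} : isCovectorCode x ↔ isCode x ∧ decode x ∈ covectors := by
  rw [isCovectorCode, Bool.and_eq_true]
  refine and_congr_right fun hx => ?_
  rw [List.all_eq_true]
  refine forall₂_congr fun c hc => ?_
  obtain ⟨hc₁, hc₂, hopp⟩ := isCode_of_mem_circuits c hc
  have h₁ := land_ne_zero hx hc₁
  have h₂ := land_ne_zero hx hc₂
  simp only [hopp] at h₂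
  rw [Orthogonal, ← h₁, ← h₂, not_iff_not]
  simp only [Bool.cond_eq_ite, Nat.beq_eq]
  split_ifs with h
  · simp only [h, true_iff, Nat.beq_eq]
  · rw [Bool.not_eq_true', ← Bool.not_eq_true, Nat.beq_eq]
    tauto

theorem bitElement_coe (e : Fin 8) : bitElement e = e := Fin.ext (Nat.mod_eq_of_lt e.2)

theorem exists_mem_codes (X : ℕ → SignType) (k : ℕ) (hk : k ≤ 8) :
    ∃ x ∈ codes k, ∀ i, x.testBit i ↔
      (i < k ∧ X i = 1) ∨ (8 ≤ i ∧ i < k + 8 ∧ X (i - 8) = -1) := by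
  induction k with
  | zero => exact ⟨0, List.mem_singleton_self _, fun i => by simp; omega⟩
  | succ k ih =>
    obtain ⟨x, hx, hbit⟩ := ih (by omega)
    have hmem : ∀ y ∈ [x, x ||| 2 ^ k, x ||| 2 ^ (k + 8)], y ∈ codes (k + 1) := fun y hy =>
      List.mem_flatMap.mpr ⟨x, hx, hy⟩
    have hlt : ∀ i, i < k + 1 ∧ X i = 1 ↔ (i < k ∧ X i = 1) ∨ (i = k ∧ X k = 1) := fun i => by
      rw [Nat.lt_succ_iff_lt_or_eq, or_and_right]
      exact or_congr_right (and_congr_right fun h => by rw [h])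
    have hlt' : ∀ i, 8 ≤ i ∧ i < k + 1 + 8 ∧ X (i - 8) = -1 ↔
        (8 ≤ i ∧ i < k + 8 ∧ X (i - 8) = -1) ∨ (i = k + 8 ∧ X k = -1) := fun i => by
      by_cases h : i = k + 8
      · subst h
        simp
      · rw [show i < k + 1 + 8 ↔ i < k + 8 by omega]
        simp [h]
    simp only [hlt, hlt']
    rcases SignType.trichotomy (X k) with h | h | h
    · refine ⟨x ||| 2 ^ (k + 8), hmem _ (by simp), fun i => ?_⟩
      simp only [Nat.testBit_or, hbit, Nat.testBit_two_pow, h, Bool.or_eq_true,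
        decide_eq_true_eq, eq_comm (a := k + 8), and_true]
      simp [or_assoc]
    · refine ⟨x, hmem _ (by simp), fun i => ?_⟩
      simp [hbit, h]
    · refine ⟨x ||| 2 ^ k, hmem _ (by simp), fun i => ?_⟩
      simp only [Nat.testBit_or, hbit, Nat.testBit_two_pow, h, Bool.or_eq_true,
        decide_eq_true_eq, eq_comm (a := k), and_true]
      tauto

theorem exists_decode_eq (X : Fin 8 → SignType) :
    ∃ x ∈ codes 8, isCode x ∧ decode x = X := by
  obtain ⟨x, hx, hbit⟩ := exists_mem_codes (fun i => X (bitElement i)) 8 le_rfl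
  have h₁ : ∀ e : Fin 8, x.testBit e ↔ X e = 1 := fun e => by
    simp [hbit, bitElement_coe, e.2.not_ge]
  have h₂ : ∀ e : Fin 8, x.testBit (e + 8) ↔ X e = -1 := fun e => by
    simp [hbit, bitElement_coe, show (e : ℕ) + 8 < 16 by omega]
  have hcode : isCode x := by
    refine isCode_iff.mpr ⟨Nat.lt_pow_two_of_testBit _ fun i hi => ?_, fun i hi₁ hi₂ => ?_⟩
    · rw [Bool.eq_false_iff, Ne, hbit]
      omega
    · have hi : i < 8 := by
        have := (hbit _).mp hi₂
        omega
      rw [h₁ ⟨i, hi⟩] at hi₁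
      rw [h₂ ⟨i, hi⟩, hi₁] at hi₂
      exact absurd hi₂ (by decide)
  refine ⟨x, hx, hcode, funext fun e => ?_⟩
  rcases SignType.trichotomy (X e) with h | h | h <;> rw [h]
  · rwa [decode_eq_neg_one hcode, h₂]
  · rw [decode_eq_zero, h₁, h₂, h]
    decide
  · rwa [decode_eq_one, h₁]

theorem mem_covectorCodes {x : ℕ} (hx : x ∈ covectorCodes) : isCode x ∧ decode x ∈ covectors :=
  isCovectorCode_iff.mp (List.mem_filter.mp hx).2

theorem exists_mem_covectorCodes {X : Fin 8 → SignType} (hX : X ∈ covectors) :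
    ∃ x ∈ covectorCodes, decode x = X := by
  obtain ⟨x, hx, hcode, rfl⟩ := exists_decode_eq X
  exact ⟨x, List.mem_filter.mpr ⟨hx, isCovectorCode_iff.mpr ⟨hcode, hX⟩⟩, rfl⟩

theorem testBit_facetMask {x n j : ℕ} (h : (facetMask x n).testBit j) :
    x.testBit j ∧ isCovectorCode (x ^^^ 2 ^ j) := by
  induction n with
  | zero => simp [facetMask] at h
  | succ n ih =>
    rw [facetMask, force_eq, Bool.cond_eq_ite, Bool.cond_eq_ite] at h
    split_ifs at h with hbit hface
    · exact ih h
    · change (2 ^ n ||| facetMask x n).testBit j at h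
      rw [Nat.testBit_or, Nat.testBit_two_pow, Bool.or_eq_true, decide_eq_true_eq] at h
      rcases h with rfl | h
      · refine ⟨?_, hface⟩
        by_contra hj
        refine hbit (Nat.beq_eq ▸ Nat.eq_of_testBit_eq fun i => ?_)
        change (x &&& 2 ^ n).testBit i = _
        rw [Nat.testBit_and, Nat.testBit_two_pow, Nat.zero_testBit]
        by_cases hi : n = i
        · rw [← hi, Bool.eq_false_iff.mpr hj, Bool.false_and]
        · simp [hi]
      · exact ih h
    · exact ih h

theorem decode_xor {x j : ℕ} (hx : isCode x) (hj : x.testBit j) (e : Fin 8) :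
    decode (x ^^^ 2 ^ j) e = if e = bitElement j then 0 else decode x e := by
  have hval := (isCode_iff.mp hx).2
  have hj16 := eq_or_eq_bitElement (lt_of_testBit hx hj)
  have h₁ : e = bitElement j ↔ (e : ℕ) = bitElement j := Fin.ext_iff
  have := e.2
  have := (bitElement j).2
  split_ifs with he
  · rw [decode_eq_zero]
    rw [← he] at hj16
    have hv := hval e
    simp only [Nat.testBit_xor, Nat.testBit_two_pow]
    rcases hj16 with h | h <;> rw [h] at hj ⊢ <;> simp [hj]
    · exact Bool.eq_false_iff.mpr (hv hj)
    · exact Bool.eq_false_iff.mpr fun h => hv h hj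
  · have h₂ : j ≠ e := by omega
    have h₃ : j ≠ e + 8 := by omega
    simp [decode, bitSign, Nat.testBit_xor, h₂, h₃]

theorem vanishes_iff {x : ℕ} {e : Fin 8} : vanishes e x ↔ decode x e = 0 := by
  rw [decode_eq_zero, vanishes, Nat.beq_eq]
  change x &&& (2 ^ (e : ℕ) ||| 2 ^ (e + 8 : ℕ)) = 0 ↔ _
  constructor
  · intro h
    have h₁ := congrArg (·.testBit e) h
    have h₂ := congrArg (·.testBit (e + 8)) h
    simp [Nat.testBit_or] at h₁ h₂
    simp [h₁, h₂]
  · rintro ⟨h₁, h₂⟩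
    refine Nat.eq_of_testBit_eq fun i => ?_
    simp only [Nat.testBit_and, Nat.testBit_or, Nat.testBit_two_pow, Nat.zero_testBit]
    grind

theorem separated_of_checkFaces {x z : ℕ} {G : List ℕ} (k : ℕ) (h : checkFaces k G)
    (hx : x ∈ G) (hz : z ∈ G) (hxz : ∀ i < k, vanishes i x = vanishes i z) :
    separated (facetMask x 16) x z := by
  induction k generalizing G with
  | zero =>
    have := List.all_eq_true.mp h x hx
    rw [force_eq] at this
    exact List.all_eq_true.mp this z hz
  | succ k ih =>
    have hk := hxz k (Nat.lt_succ_self k)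
    have hi := fun i hi => hxz i (Nat.lt_succ_of_lt hi)
    rw [checkFaces, Bool.and_eq_true, withFilter_eq, withFilter_eq] at h
    cases hv : vanishes k x
    · exact ih h.2 (by simp [hx, hv]) (by simp [hz, ← hk, hv]) hi
    · exact ih h.1 (by simp [hx, hv]) (by simp [hz, ← hk, hv]) hi

set_option maxRecDepth 100000 in
set_option maxHeartbeats 0 in
theorem withFilter_checkCovectors : withFilter isCovectorCode checkCovectors (codes 8) [] := by
  decide +kernel

theorem checkCovectors_covectorCodes : checkCovectors covectorCodes.reverse := by
  have := withFilter_checkCovectors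
  rwa [withFilter_eq, List.append_nil] at this

theorem zero_mem_covectors : (fun _ => 0) ∈ covectors := fun _ _ => by simp [Orthogonal]

theorem neg_mem_covectors : ∀ X ∈ covectors, -X ∈ covectors := fun _ hX c hc => (hX c hc).neg

theorem hasSeparatingFaces_covectors : HasSeparatingFaces covectors := by
  intro X hX Y hY hsupp hne
  obtain ⟨x, hx, rfl⟩ := exists_mem_covectorCodes hX
  obtain ⟨z, hz, hzY⟩ := exists_mem_covectorCodes (neg_mem_covectors Y hY)
  obtain rfl : Y = -decode z := by rw [hzY, neg_neg]
  have hcx := (mem_covectorCodes hx).1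
  have hcz := (mem_covectorCodes hz).1
  have hsupp' : ∀ e, decode x e = 0 ↔ decode z e = 0 := fun e => by
    rw [hsupp e, Pi.neg_apply]
    generalize decode z e = s
    revert s
    decide
  have hsep : separated (facetMask x 16) x z := by
    have h := checkCovectors_covectorCodes
    simp only [checkCovectors, Bool.and_eq_true] at h
    refine separated_of_checkFaces 8 h.1.1 (List.mem_reverse.mpr hx) (List.mem_reverse.mpr hz)
      fun i hi => ?_
    have := hsupp' ⟨i, hi⟩
    rw [← vanishes_iff, ← vanishes_iff] at this
    exact Bool.eq_iff_iff.mpr this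
  simp only [separated, Bool.cond_eq_ite, Nat.beq_eq] at hsep
  by_cases hF : Nat.land (facetMask x 16) z = 0
  on_goal 1 => rw [if_pos hF, Bool.or_eq_true, Nat.beq_eq, Nat.beq_eq] at hsep
  on_goal 1 => rcases hsep with rfl | h
  · refine ⟨fun _ => 0, zero_mem_covectors, fun h => hne ?_, fun e => Or.inl rfl, fun e _ _ => rfl⟩
    rw [← h]
    ext e
    simp
  · refine absurd (funext fun e => ?_) hne
    by_contra hcon
    refine (land_ne_zero hcx hcz).mpr ⟨e, ?_⟩ h
    have := hsupp' e
    rw [Pi.neg_apply] at hcon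
    revert this hcon
    generalize decode x e = a
    generalize decode z e = b
    revert a b
    decide
  · obtain ⟨j, hj⟩ := exists_testBit_of_ne_zero hF
    change (facetMask x 16 &&& z).testBit j at hj
    rw [Nat.testBit_and, Bool.and_eq_true] at hj
    obtain ⟨hxj, hface⟩ := testBit_facetMask hj.1
    obtain ⟨h0, heq⟩ := decode_eq_of_testBit hcx hcz hxj hj.2
    refine ⟨_, (isCovectorCode_iff.mp hface).2, fun h => h0 ?_, fun e => ?_, fun e he hne => ?_⟩
    · rw [← h, decode_xor hcx hxj, if_pos rfl]
    · rw [decode_xor hcx hxj]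
      exact (ite_eq_or_eq _ _ _).imp id id
    · rw [decode_xor hcx hxj] at he
      split_ifs at he with hej
      · rw [hej, Pi.neg_apply, heq]
      · exact absurd he hne

theorem isOrientedMatroid_covectors : IsOrientedMatroid covectors :=
  isOrientedMatroid_of_hasSeparatingFaces zero_mem_covectors neg_mem_covectors
    (fun _ hX _ hY c hc => (hX c hc).signComp (hY c hc)) hasSeparatingFaces_covectors

theorem isCovectorCode_mem {x : ℕ} (hx : isCovectorCode x) : decode x ∈ covectors :=
  (isCovectorCode_iff.mp hx).2

theorem card_zeros_le {x : ℕ} (hx : x ∈ covectorCodes) :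
    x = 0 ∨ (Finset.univ.filter fun e => decode x e = 0).card ≤ 3 := by
  have h := checkCovectors_covectorCodes
  simp only [checkCovectors, Bool.and_eq_true, List.all_eq_true] at h
  have hx' := h.1.2 x (List.mem_reverse.mpr hx)
  simp only [hasFewZeros, Bool.or_eq_true, Nat.beq_eq, Nat.ble_eq] at hx'
  refine hx'.imp_right fun h => ?_
  rw [← List.toFinset_card_of_nodup (List.Nodup.filter _ (List.nodup_finRange 8))] at h
  refine (Finset.card_le_card fun e he => ?_).trans h
  rw [Finset.mem_filter] at he
  exact List.mem_toFinset.mpr (List.mem_filter.mpr ⟨List.mem_finRange e, vanishes_iff.mpr he.2⟩)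

/-- The entry recorded by a bit. -/
def bitEntry (j : ℕ) : SignType := if j < 8 then 1 else -1

theorem testBit_iff {x j : ℕ} (hx : isCode x) (hj : j < 16) :
    x.testBit j ↔ decode x (bitElement j) = bitEntry j := by
  rw [bitEntry]
  split_ifs with h
  · rw [decode_eq_one, show (bitElement j : ℕ) = j from Nat.mod_eq_of_lt h]
  · rw [decode_eq_neg_one hx, show (bitElement j : ℕ) + 8 = j by simp only [bitElement]; omega]

theorem masks_spec : ∀ q ∈ eliminations,
    Nat.land (Nat.lor q.1 q.2.1) (agreementMask q.1 q.2.1) < 2 ^ 16 ∧ ∀ j : Fin 16,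
      ((Nat.lor (agreementMask q.1 q.2.1) (257 * 2 ^ q.2.2.1)).testBit j →
        bitElement j = bitElement q.2.2.1 ∨ ¬(decode q.1 (bitElement j) ≠ 0 ∧
          decode q.1 (bitElement j) = -decode q.2.1 (bitElement j))) ∧
      ((Nat.land (Nat.lor q.1 q.2.1) (agreementMask q.1 q.2.1)).testBit j ↔
        (Nat.lor (agreementMask q.1 q.2.1) (257 * 2 ^ q.2.2.1)).testBit j ∧
          bitElement j ≠ bitElement q.2.2.1 ∧
          signComp (decode q.1) (decode q.2.1) (bitElement j) = bitEntry j) := by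
  unfold signComp
  decide +kernel

theorem eliminations_unique {z : ℕ} (hz : z ∈ covectorCodes) {q : ℕ × ℕ × ℕ × ℕ}
    (hq : q ∈ eliminations) (h0 : decode z (bitElement q.2.2.1) = 0)
    (h : ∀ f, ¬(decode q.1 f ≠ 0 ∧ decode q.1 f = -decode q.2.1 f) →
      decode z f = signComp (decode q.1) (decode q.2.1) f) : z = q.2.2.2 := by
  have hc := checkCovectors_covectorCodes
  simp only [checkCovectors, Bool.and_eq_true] at hc
  have hz' := List.all_eq_true.mp hc.2 q hq
  rw [checkElimination, force_eq, force_eq] at hz'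
  replace hz' := List.all_eq_true.mp hz' z (List.mem_reverse.mpr hz)
  simp only [Bool.cond_eq_ite, Nat.beq_eq] at hz'
  have hcode := (mem_covectorCodes hz).1
  obtain ⟨hlt, hbits⟩ := masks_spec q hq
  rw [if_pos, Nat.beq_eq] at hz'
  · exact hz'
  refine Nat.eq_of_testBit_eq fun j => ?_
  by_cases hj : j < 16
  · obtain ⟨h₁, h₂⟩ := hbits ⟨j, hj⟩
    rw [Bool.eq_iff_iff]
    refine Iff.trans ?_ h₂.symm
    refine (iff_of_eq (congrArg (· = true) (Nat.testBit_and _ _ _))).trans ?_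
    rw [Bool.and_eq_true, testBit_iff hcode hj, and_comm]
    refine and_congr_right fun hmask => ?_
    rcases eq_or_ne (bitElement j) (bitElement q.2.2.1) with he | he
    · refine iff_of_false (fun hz0 => ?_) fun h' => h'.1 he
      rw [he, h0, bitEntry] at hz0
      split_ifs at hz0
    · rw [h _ ((h₁ hmask).resolve_left he)]
      exact (and_iff_right he).symm
  · have hj16 := Nat.pow_le_pow_right two_pos (not_lt.mp hj)
    rw [Nat.testBit_lt_two_pow (hlt.trans_le hj16)]
    refine Nat.testBit_lt_two_pow (lt_of_le_of_lt ?_ ((isCode_iff.mp hcode).1.trans_le hj16))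
    exact Nat.and_le_left

theorem decode_zero : decode 0 = fun _ => 0 := funext fun _ => decode_eq_zero.mpr (by simp)

theorem card_zeros_le_of_mem {X : Fin 8 → SignType} (hX : X ∈ covectors) (h0 : X ≠ fun _ => 0) :
    (Finset.univ.filter fun e => X e = 0).card ≤ 3 := by
  obtain ⟨x, hx, rfl⟩ := exists_mem_covectorCodes hX
  refine (card_zeros_le hx).resolve_left ?_
  rintro rfl
  exact h0 decode_zero

theorem card_zeros_lt {E : Type*} [Fintype E] {X Y : E → SignType} (hle : covLE X Y)
    (hne : X ≠ Y) :
    (Finset.univ.filter fun e => Y e = 0).card < (Finset.univ.filter fun e => X e = 0).card := by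
  obtain ⟨e, he⟩ := Function.ne_iff.mp hne
  have h0 := (hle e).resolve_right he
  refine Finset.card_lt_card ((Finset.ssubset_iff_of_subset fun f hf => ?_).mpr ⟨e, ?_, ?_⟩)
  · simp only [Finset.mem_filter, Finset.mem_univ, true_and] at hf ⊢
    exact (hle f).elim id fun h => h.trans hf
  · simpa using h0
  · simpa [h0, eq_comm] using he

/-- The classes of parallel elements of the twelve-element oriented matroid. -/
def parallelClass (j : Fin 12) : Fin 8 := bitElement j

theorem parallelClass_surjective : Function.Surjective parallelClass := by decide

/-- The covectors of the twelve-element oriented matroid. -/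
def extendedCovectors : Set (Fin 12 → SignType) := (fun X => X ∘ parallelClass) '' covectors

theorem hasRank_extendedCovectors : HasRank extendedCovectors 4 := by
  constructor
  · have hmem : ∀ i, isCovectorCode (![0, 227, 243, 251, 255] i) := by decide +kernel
    have hlt : ∀ i j : Fin 5, i < j →
        (∀ e, decode (![0, 227, 243, 251, 255] i) e = 0 ∨
          decode (![0, 227, 243, 251, 255] i) e = decode (![0, 227, 243, 251, 255] j) e) ∧
        ∃ e, decode (![0, 227, 243, 251, 255] i) e ≠ decode (![0, 227, 243, 251, 255] j) e := by
      decide +kernel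
    refine ⟨fun i => decode (![0, 227, 243, 251, 255] i) ∘ parallelClass,
      fun i => ⟨_, isCovectorCode_mem (hmem i), rfl⟩, fun i j hij => ⟨fun e => (hlt i j hij).1 _,
      fun h => ?_⟩⟩
    obtain ⟨e, he⟩ := (hlt i j hij).2
    exact he (congrFun (parallelClass_surjective.injective_comp_right h) e)
  · rintro ⟨c, hc, hlt⟩
    choose X hX hXc using hc
    have hlt' : ∀ i j : Fin 6, i < j → covLE (X i) (X j) ∧ X i ≠ X j := fun i j hij => by
      obtain ⟨hle, hne⟩ := hlt i j hij
      refine ⟨fun e => ?_, fun h => hne (by rw [← hXc, ← hXc, h])⟩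
      obtain ⟨f, rfl⟩ := parallelClass_surjective e
      have := hle f
      rwa [← hXc, ← hXc] at this
    have h0 : X 1 ≠ fun _ => 0 := fun h => by
      obtain ⟨hle, hne⟩ := hlt' 0 1 (by decide)
      refine hne (funext fun e => (hle e).elim (fun h' => ?_) id)
      rw [h', h]
    have hcard := fun i j hij => card_zeros_lt (hlt' i j hij).1 (hlt' i j hij).2
    have h1 := card_zeros_le_of_mem (hX 1) h0
    have h2 := hcard 1 2 (by decide)
    have h3 := hcard 2 3 (by decide)
    have h4 := hcard 3 4 (by decide)
    have h5 := hcard 4 5 (by decide)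
    omega

theorem one_mem_extendedCovectors : (fun _ => 1) ∈ extendedCovectors :=
  ⟨decode 255, isCovectorCode_mem (by decide +kernel), funext fun e =>
    (by decide +kernel : ∀ e, decode 255 e = 1) (parallelClass e)⟩

/-! ### The obstruction -/

/-! ### The obstruction -/

theorem eliminations_spec : ∀ q ∈ eliminations, isCovectorCode q.2.1 ∧
    decode q.1 (bitElement q.2.2.1) ≠ 0 ∧
    decode q.1 (bitElement q.2.2.1) = -decode q.2.1 (bitElement q.2.2.1) := by
  decide +kernel

variable {M : Set (Pairs 12 → SignType)}

/-- The covector coded by `x` lifts with sign `s` on the pair `(0, 1)`. -/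
def LiftsCode (M : Set (Pairs 12 → SignType)) (x : ℕ) (s : SignType) : Prop :=
  Lifts M 0 1 (decode x ∘ parallelClass) s

theorem exists_liftsCode (hL : LittleCovectors M = extendedCovectors) {x : ℕ}
    (hx : isCovectorCode x) : ∃ s, LiftsCode M x s :=
  exists_lifts (hL ▸ ⟨_, isCovectorCode_mem hx, rfl⟩)

theorem LiftsCode.step (hM : IsOrientedMatroid M) (hbraid : ∀ X ∈ M, IsBraidCovector X)
    (hL : LittleCovectors M = extendedCovectors) {q : ℕ × ℕ × ℕ × ℕ} (hq : q ∈ eliminations)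
    {s t : SignType} (hs : LiftsCode M q.1 s) (ht : LiftsCode M q.2.1 t) (hst : s = 0 ∨ s = t) :
    LiftsCode M q.2.2.2 t := by
  obtain ⟨-, hne, hsep⟩ := eliminations_spec q hq
  obtain ⟨i, hi⟩ := parallelClass_surjective (bitElement q.2.2.1)
  obtain ⟨Z, u, hZ, hZi, hZf, hu⟩ := hs.elim hM hbraid ht (i := i)
    (by rwa [Function.comp_apply, hi]) (by simpa only [Function.comp_apply, hi] using hsep)
  have hmem : Z ∈ extendedCovectors := hL ▸ hZ.1
  obtain ⟨_, hX, rfl⟩ := hmem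
  obtain ⟨z, hz, rfl⟩ := exists_mem_covectorCodes hX
  have hzq : z = q.2.2.2 := eliminations_unique hz hq (by rwa [← hi]) fun f hf => by
    obtain ⟨j, rfl⟩ := parallelClass_surjective f
    exact hZf j hf
  have hut : u = t := by
    revert hst hu
    clear * -
    revert s t u
    decide
  rwa [← hut, ← hzq]

theorem LiftsCode.descend (hM : IsOrientedMatroid M) (hbraid : ∀ X ∈ M, IsBraidCovector X)
    (hL : LittleCovectors M = extendedCovectors) {q : ℕ × ℕ × ℕ × ℕ} (hq : q ∈ descents)
    {s : SignType} (hs : LiftsCode M q.1 s) (h : s = 0 ∨ s = -1) : LiftsCode M q.2.2.2 (-1) := by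
  have hspec : ∀ q ∈ descents, decode q.2.1 0 = 1 ∧ decode q.2.1 1 = 0 := by decide +kernel
  have hq' : q ∈ eliminations := by simp [eliminations, hq]
  obtain ⟨t, ht⟩ := exists_liftsCode hL (eliminations_spec q hq').1
  obtain rfl : t = -1 := ht.eq_neg_one (hspec q hq).1 (hspec q hq).2
  exact hs.step hM hbraid hL hq' ht h

theorem LiftsCode.ascend (hM : IsOrientedMatroid M) (hbraid : ∀ X ∈ M, IsBraidCovector X)
    (hL : LittleCovectors M = extendedCovectors) {q : ℕ × ℕ × ℕ × ℕ} (hq : q ∈ ascents)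
    (hs : LiftsCode M q.1 1) : LiftsCode M q.2.2.2 1 := by
  have hspec : ∀ q ∈ ascents, decode q.2.1 0 = 0 ∧ decode q.2.1 1 = 1 := by decide +kernel
  have hq' : q ∈ eliminations := by simp [eliminations, hq]
  obtain ⟨t, ht⟩ := exists_liftsCode hL (eliminations_spec q hq').1
  obtain rfl : t = 1 := ht.eq_one (hspec q hq).1 (hspec q hq).2
  exact hs.step hM hbraid hL hq' ht (Or.inr rfl)

theorem not_liftsCode_vertices (hM : IsOrientedMatroid M) (hbraid : ∀ X ∈ M, IsBraidCovector X)
    (hL : LittleCovectors M = extendedCovectors) {s : SignType} (hs : s ≠ 0)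
    (h₁ : LiftsCode M 227 s) (h₂ : LiftsCode M 211 s) (h₃ : LiftsCode M 203 s)
    (h₄ : LiftsCode M 199 s) : False := by
  have hneg : ∀ {x y : ℕ}, isCovectorCode y → (∀ e, decode y e = -decode x e) →
      LiftsCode M x s → LiftsCode M y (-s) := fun {x y} hy hxy h => by
    have heq : decode y ∘ parallelClass = -(decode x ∘ parallelClass) := funext fun j => hxy _
    rw [LiftsCode, heq]
    exact Lifts.neg hM (heq ▸ hL ▸ ⟨_, isCovectorCode_mem hy, rfl⟩) h
  have htop : LiftsCode M 255 0 := by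
    have h1 : decode 255 ∘ parallelClass = fun _ => 1 :=
      funext fun j => (by decide +kernel : ∀ e, decode 255 e = 1) (parallelClass j)
    rw [LiftsCode, h1]
    exact lifts_one_zero hM (hL ▸ one_mem_extendedCovectors)
  have hstep : ∀ {q : ℕ × ℕ × ℕ × ℕ} {t : SignType}, q ∈ closings → LiftsCode M q.1 t →
      LiftsCode M q.2.1 (-s) → t = 0 ∨ t = -s → LiftsCode M q.2.2.2 (-s) :=
    fun hq ht hs hts => ht.step hM hbraid hL (by simp [eliminations, hq]) hs hts
  have hfacet := hstep (q := (255, 58112, 5, 223)) (by decide) htop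
    (hneg (by decide +kernel) (by decide +kernel) h₁) (Or.inl rfl)
  have hedge := hstep (q := (223, 54016, 4, 207)) (by decide) hfacet
    (hneg (by decide +kernel) (by decide +kernel) h₂) (Or.inr rfl)
  have hvertex := hstep (q := (207, 51968, 3, 199)) (by decide) hedge
    (hneg (by decide +kernel) (by decide +kernel) h₃) (Or.inr rfl)
  have hzero := hstep (q := (199, 50944, 2, 0)) (by decide) hvertex
    (hneg (by decide +kernel) (by decide +kernel) h₄) (Or.inr rfl)
  rw [LiftsCode, decode_zero] at hzero
  exact hs ((by decide : ∀ s : SignType, -s = 0 → s = 0) s (Lifts.eq_zero hzero))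

theorem littleCovectors_ne_extendedCovectors (hM : IsOrientedMatroid M)
    (hbraid : ∀ X ∈ M, IsBraidCovector X) : LittleCovectors M ≠ extendedCovectors := by
  intro hL
  obtain ⟨s, hs⟩ := exists_liftsCode hL (x := 227) (by decide +kernel)
  by_cases h : s = 1
  · subst h
    have h₁ := hs.ascend hM hbraid hL (q := (227, 24722, 5, 211)) (by decide)
    have h₂ := h₁.ascend hM hbraid hL (q := (211, 53258, 4, 203)) (by decide)
    have h₃ := h₂.ascend hM hbraid hL (q := (203, 53258, 7, 4171)) (by decide)
    have h₄ := h₃.ascend hM hbraid hL (q := (4171, 28682, 6, 12299)) (by decide)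
    have h₅ := h₄.ascend hM hbraid hL (q := (12299, 10262, 4, 10247)) (by decide)
    have h₆ := h₅.ascend hM hbraid hL (q := (10247, 9354, 3, 8327)) (by decide)
    have h₇ := h₆.ascend hM hbraid hL (q := (8327, 1250, 5, 199)) (by decide)
    exact not_liftsCode_vertices hM hbraid hL one_ne_zero hs h₁ h₂ h₇
  · have h' : s = 0 ∨ s = -1 :=
      (by decide : ∀ s : SignType, s ≠ 1 → s = 0 ∨ s = -1) s h
    have h₁ := hs.descend hM hbraid hL (q := (227, 57349, 5, 199)) (by decide) h'
    have h₂ := h₁.descend hM hbraid hL (q := (199, 57349, 6, 8327)) (by decide) (Or.inr rfl)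
    have h₃ := h₂.descend hM hbraid hL (q := (8327, 43013, 7, 10247)) (by decide) (Or.inr rfl)
    have h₄ := h₃.descend hM hbraid hL (q := (10247, 5161, 2, 12299)) (by decide) (Or.inr rfl)
    have h₅ := h₄.descend hM hbraid hL (q := (12299, 6241, 5, 4171)) (by decide) (Or.inr rfl)
    have h₆ := h₅.descend hM hbraid hL (q := (4171, 2257, 4, 203)) (by decide) (Or.inr rfl)
    have h₇ := h₆.descend hM hbraid hL (q := (203, 2257, 3, 211)) (by decide) (Or.inr rfl)
    have h₈ := h₇.descend hM hbraid hL (q := (211, 36961, 4, 227)) (by decide) (Or.inr rfl)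
    exact not_liftsCode_vertices hM hbraid hL (by decide) h₈ h₇ h₆ h₁

end Code

end NonSweepable

/-- There is an acyclic oriented matroid of rank `4` on `12` elements (a suitable
reorientation of Richter-Gebert's oriented matroid) that is not the little oriented
matroid of any sweep oriented matroid, i.e. it cannot be extended to a big oriented
matroid. -/
theorem exists_acyclic_not_little :
    ∃ C : Set (Fin 12 → SignType),
      IsOrientedMatroid C ∧ HasRank C 4 ∧
      ((fun _ => (1 : SignType)) ∈ C ∧
        ∀ Y ∈ C, covLE (fun _ => (1 : SignType)) Y → Y = fun _ => (1 : SignType)) ∧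
      ¬ ∃ M : Set (Pairs 12 → SignType),
          IsOrientedMatroid M ∧ (∀ X ∈ M, IsBraidCovector X) ∧
          LittleCovectors M = C := by
  refine ⟨NonSweepable.extendedCovectors,
    NonSweepable.isOrientedMatroid_image_comp NonSweepable.isOrientedMatroid_covectors _,
    NonSweepable.hasRank_extendedCovectors, ⟨NonSweepable.one_mem_extendedCovectors,
      fun Y _ hY => funext fun e => ((hY e).resolve_left one_ne_zero).symm⟩, ?_⟩
  rintro ⟨M, hM, hbraid, hL⟩
  exact NonSweepable.littleCovectors_ne_extendedCovectors hM hbraid hL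
end

section
/- Every loopless acyclic oriented matroid of rank 3 is the little oriented matroid of some sweep oriented matroid. -/
/-- Elements `i` and `j` take the same sign in every covector. -/
def Par {E : Type*} (C : Set (E → SignType)) (i j : E) : Prop := ∀ X ∈ C, X i = X j

section General

variable {E : Type*} {C : Set (E → SignType)}

theorem Par.symm {i j : E} (h : Par C i j) : Par C j i := fun X hX => (h X hX).symm

theorem Par.trans {i j k : E} (h : Par C i j) (h' : Par C j k) : Par C i k :=
  fun X hX => (h X hX).trans (h' X hX)

/-- Eliminating `e` between `X` and `-Y` yields a covector recording the sign of `X - Y`. -/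
theorem IsOrientedMatroid.exists_diff (h : IsOrientedMatroid C) {X Y : E → SignType}
    (hX : X ∈ C) (hY : Y ∈ C) {e : E} (he : X e = Y e) (h0 : X e ≠ 0) :
    ∃ Z ∈ C, Z e = 0 ∧ ∀ f, (X f < Y f → Z f = -1) ∧ (Y f < X f → Z f = 1) ∧
      (X f = 0 → Y f = 0 → Z f = 0) := by
  obtain ⟨Z, hZ, hZe, hZf⟩ := h.2.2.2 X hX (-Y) (h.2.1 Y hY) e h0 (by simp [he])
  refine ⟨Z, hZ, hZe, fun f => ?_⟩
  have := hZf f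
  simp only [signComp, Pi.neg_apply] at this
  generalize X f = x at *
  generalize Y f = y at *
  generalize Z f = z at *
  clear hZf hZe he h0
  revert x y z
  decide

/-- A covector `X` of full support different from `Y = ±X` (elementwise) has a facet lying
between `X` and `Y`, and the elements vanishing there are parallel or antiparallel. -/
theorem IsOrientedMatroid.exists_facet [Finite E] (h : IsOrientedMatroid C)
    {X Y : E → SignType} (hX : X ∈ C) (hY : Y ∈ C) (hne : Y ≠ X)
    (hsupp : ∀ V ∈ C, ∀ k, X k = 0 → V k = 0) (hXY : ∀ k, Y k = X k ∨ Y k = -X k) :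
    ∃ i, X i ≠ 0 ∧ ∃ Z ∈ C, Z i = 0 ∧ ∀ k, Z k = X k ∨
      (Z k = 0 ∧ Y k = -X k ∧ ∀ V ∈ C, V k * X i = V i * X k) := by
  obtain ⟨W, ⟨hWC, hWne, hW⟩, hmin⟩ := Set.exists_min_image
    {W | W ∈ C ∧ W ≠ X ∧ ∀ k, W k = X k ∨ (W k = -X k ∧ Y k = -X k)}
    (fun W => {k | W k ≠ X k}.ncard) (Set.toFinite _)
    ⟨Y, hY, hne, fun k => (hXY k).imp id fun h => ⟨h, h⟩⟩
  have key : ∀ U ∈ C, (∀ f, U f = X f ∨ (U f = -X f ∧ W f ≠ X f)) →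
      U = X ∨ ∀ f, W f ≠ X f → U f ≠ X f := by
    intro U hU hUf
    by_cases hUX : U = X
    · exact Or.inl hUX
    right
    have hcard := hmin U ⟨hU, hUX, fun k => (hUf k).imp id fun hk =>
      ⟨hk.1, ((hW k).resolve_left hk.2).2⟩⟩
    have hsub : {k | U k ≠ X k} ⊆ {k | W k ≠ X k} := fun k hk => ((hUf k).resolve_left hk).2
    have := Set.eq_of_subset_of_ncard_le hsub hcard (Set.toFinite _)
    intro f hf
    have : f ∈ {k | U k ≠ X k} := by rw [this]; exact hf
    exact this
  obtain ⟨i, hi⟩ := Function.ne_iff.mp hWne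
  have hi' := ((hW i).resolve_left hi).1
  have hXi : X i ≠ 0 := fun h0 => hi (by rw [hi', h0]; rfl)
  obtain ⟨Z, hZ, hZi, hZf⟩ := h.2.2.2 X hX W hWC i hXi (by rw [hi', neg_neg])
  have hZ1 : ∀ f, W f = X f → Z f = X f := by
    intro f hf
    have := hZf f
    rw [signComp, hf] at this
    generalize X f = x at *
    generalize Z f = z at *
    clear hf
    revert x z
    decide
  have hWX : ∀ f, W f ≠ X f → W f = -X f := fun f hf => ((hW f).resolve_left hf).1
  have hX0 : ∀ f, W f ≠ X f → X f ≠ 0 := by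
    intro f hf h0
    exact hf (by rw [hWX f hf, h0]; rfl)
  have hpm : ∀ U ∈ C, ∀ f, signComp Z (signComp U X) f = X f ∨
      (signComp Z (signComp U X) f = -X f ∧ W f ≠ X f) := by
    intro U hU f
    by_cases hf : W f = X f
    · left
      have h1 := hZ1 f hf
      have h2 := hsupp U hU f
      simp only [signComp, h1]
      generalize X f = x at *
      generalize U f = u at *
      clear hf h1
      revert x u
      decide
    · have := hX0 f hf
      simp only [signComp, hf, ne_eq, not_false_eq_true, and_true]
      generalize X f = x at *
      generalize Z f = z at *
      generalize U f = u at *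
      clear hf
      revert x z u
      decide
  have key' : ∀ U ∈ C, signComp Z (signComp U X) = X ∨
      ∀ f, W f ≠ X f → signComp Z (signComp U X) f ≠ X f := fun U hU =>
    key _ (h.2.2.1 _ hZ _ (h.2.2.1 _ hU _ hX)) (hpm U hU)
  have hZX : ∀ f, W f ≠ X f → Z f = 0 ∨ Z f = X f := by
    intro f hf
    rcases key' X hX with h1 | h1
    · have := congrFun h1 f
      simp only [signComp] at this
      generalize X f = x at *
      generalize Z f = z at *
      clear hf
      revert x z
      decide
    · exact absurd (by simp [signComp, hZi]) (h1 i hi)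
  have hZ0 : ∀ f, W f ≠ X f → Z f = 0 := by
    intro f hf
    rcases key' W hWC with h1 | h1
    · exfalso
      have h2 := congrFun h1 i
      simp only [signComp, hZi, hi', if_true] at h2
      generalize X i = x at *
      clear hi' hi
      revert x
      decide
    · have h2 := h1 f hf
      have h3 := hZX f hf
      simp only [signComp] at h2
      by_contra h0
      exact h2 (by rw [if_neg h0]; exact h3.resolve_left h0)
  refine ⟨i, hXi, Z, hZ, hZi, fun k => ?_⟩
  by_cases hk : W k = X k
  · exact Or.inl (hZ1 k hk)
  refine Or.inr ⟨hZ0 k hk, ((hW k).resolve_left hk).2, fun V hV => ?_⟩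
  have hiff : ∀ U ∈ C, signComp U X i = X i ↔ signComp U X k = X k := by
    intro U hU
    have e : ∀ f, Z f = 0 → signComp Z (signComp U X) f = signComp U X f := by
      intro f hf
      simp [signComp, hf]
    rcases key' U hU with h1 | h1
    · rw [← e i hZi, ← e k (hZ0 k hk), h1]
      simp
    · rw [← e i hZi, ← e k (hZ0 k hk)]
      simp [h1 i hi, h1 k hk]
  have h1 := hiff V hV
  have h2 := hiff (-V) (h.2.1 V hV)
  have h3 := hX0 k hk
  simp only [signComp, Pi.neg_apply] at h1 h2
  clear hiff hZi hi' hi hk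
  generalize X i = xi at *
  generalize X k = xk at *
  generalize V i = vi at *
  generalize V k = vk at *
  revert xi xk vi vk
  decide

theorem IsOrientedMatroid.exists_eq_zero_eq_one (h : IsOrientedMatroid C)
    (h1 : (fun _ => (1 : SignType)) ∈ C) {i j : E} (hij : ¬Par C i j) :
    ∃ U ∈ C, U i = 0 ∧ U j = 1 := by
  obtain ⟨V, hV, hne⟩ : ∃ V ∈ C, V i ≠ V j := by simpa [Par] using hij
  obtain ⟨W, hW, hWi, hWj⟩ : ∃ W ∈ C, W i = 1 ∧ W j = -1 := by
    have m1 := h.2.1 _ h1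
    have a := h.2.2.1 V hV _ m1
    have b := h.2.1 _ (h.2.2.1 V hV _ h1)
    have c := h.2.1 _ a
    have d := h.2.2.1 V hV _ h1
    have : (∃ x y : SignType, V i = x ∧ V j = y ∧ x ≠ y) := ⟨_, _, rfl, rfl, hne⟩
    obtain ⟨x, y, hx, hy, hxy⟩ := this
    have cases4 : (signComp V (-fun _ => (1 : SignType)) i = 1 ∧
        signComp V (-fun _ => (1 : SignType)) j = -1) ∨
        ((-signComp V (fun _ => (1 : SignType))) i = 1 ∧
        (-signComp V (fun _ => (1 : SignType))) j = -1) ∨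
        ((-signComp V (-fun _ => (1 : SignType))) i = 1 ∧
        (-signComp V (-fun _ => (1 : SignType))) j = -1) ∨
        (signComp V (fun _ => (1 : SignType)) i = 1 ∧
        signComp V (fun _ => (1 : SignType)) j = -1) := by
      simp only [signComp, Pi.neg_apply, hx, hy]
      clear hx hy
      revert x y
      decide
    rcases cases4 with h' | h' | h' | h'
    exacts [⟨_, a, h'⟩, ⟨_, b, h'⟩, ⟨_, c, h'⟩, ⟨_, d, h'⟩]
  obtain ⟨Z, hZ, hZi, hZf⟩ := h.exists_diff h1 hW (e := i) hWi.symm one_ne_zero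
  exact ⟨Z, hZ, hZi, (hZf j).2.1 (by rw [hWj]; decide)⟩

/-- The strict conformal order. -/
def CovLT (X Y : E → SignType) : Prop := covLE X Y ∧ X ≠ Y

theorem CovLT.trans {X Y Z : E → SignType} (h : CovLT X Y) (h' : CovLT Y Z) : CovLT X Z := by
  have hle : covLE X Z := fun e => by
    rcases h.1 e with h1 | h1
    · exact Or.inl h1
    · rw [h1]; exact h'.1 e
  refine ⟨hle, fun he => h.2 (funext fun e => ?_)⟩
  subst he
  rcases h.1 e with h1 | h1
  · rcases h'.1 e with h2 | h2
    · rw [h1, h2]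
    · exact h2.symm
  · exact h1

theorem CovLT.exists_zero_ne {X Y : E → SignType} (h : CovLT X Y) : ∃ f, X f = 0 ∧ Y f ≠ 0 := by
  obtain ⟨f, hf⟩ := Function.ne_iff.mp h.2
  have := (h.1 f).resolve_right hf
  exact ⟨f, this, fun h0 => hf (this.trans h0.symm)⟩

theorem covLT_signComp {X Y : E → SignType} {e : E} (hX : X e = 0) (hY : Y e ≠ 0) :
    CovLT X (signComp X Y) := by
  refine ⟨fun f => ?_, fun he => ?_⟩
  · by_cases h : X f = 0 <;> simp [signComp, h]
  · have := congrFun he e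
    simp only [signComp, hX, if_true] at this
    exact hY this.symm

theorem hasChain_four {A B D F G : E → SignType} (hA : A ∈ C) (hB : B ∈ C) (hD : D ∈ C)
    (hF : F ∈ C) (hG : G ∈ C) (h1 : CovLT A B) (h2 : CovLT B D) (h3 : CovLT D F)
    (h4 : CovLT F G) : HasChain C 4 := by
  refine ⟨![A, B, D, F, G], ?_, ?_⟩
  · simp [Fin.forall_fin_succ, *]
  · intro i j hij
    change CovLT _ _
    have := h1.trans h2
    have := h2.trans h3
    have := h3.trans h4
    have := (h1.trans h2).trans h3
    have := (h2.trans h3).trans h4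
    have := ((h1.trans h2).trans h3).trans h4
    fin_cases i <;> fin_cases j <;> first | assumption | (exfalso; revert hij; decide)

theorem IsOrientedMatroid.eq_or_eq_neg_of_rank (h : IsOrientedMatroid C)
    (h1 : (fun _ => (1 : SignType)) ∈ C) (hr : ¬HasChain C 4) {i j : E} (hij : ¬Par C i j)
    {X Y : E → SignType} (hX : X ∈ C) (hY : Y ∈ C) (hXi : X i = 0) (hXj : X j = 0)
    (hYi : Y i = 0) (hYj : Y j = 0) (hX0 : X ≠ 0) (hY0 : Y ≠ 0) : X = Y ∨ X = -Y := by
  have key : ∀ A B : E → SignType, A ∈ C → B ∈ C → A i = 0 → A j = 0 → B i = 0 → B j = 0 →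
      A ≠ 0 → ∀ e, A e = 0 → B e = 0 := by
    intro A B hA hB hAi hAj hBi hBj hA0 e hAe
    by_contra hBe
    obtain ⟨U, hU, hUi, hUj⟩ := h.exists_eq_zero_eq_one h1 hij
    refine hr (hasChain_four h.1 hA (h.2.2.1 _ hA _ hB)
      (h.2.2.1 _ (h.2.2.1 _ hA _ hB) _ hU)
      (h.2.2.1 _ (h.2.2.1 _ (h.2.2.1 _ hA _ hB) _ hU) _ h1) ⟨fun _ => Or.inl rfl, Ne.symm hA0⟩
      (covLT_signComp hAe hBe) (covLT_signComp (e := j) ?_ ?_) (covLT_signComp (e := i) ?_ ?_))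
    all_goals simp [signComp, *]
  have hs := key X Y hX hY hXi hXj hYi hYj hX0
  by_contra! hne
  obtain ⟨e, he⟩ := Function.ne_iff.mp hne.1
  obtain ⟨f, hf⟩ := Function.ne_iff.mp hne.2
  have hs' := key Y X hY hX hYi hYj hXi hXj hY0
  obtain ⟨Z, hZ, hZf, hZ'⟩ := h.exists_diff hX hY (e := f)
    (by
      have a := hs f
      have b := hs' f
      rw [Pi.neg_apply] at hf
      generalize X f = x at *
      generalize Y f = y at *
      revert x y
      decide)
    (fun h0 => hf (by simp [h0, hs f h0]))
  have hZe : Z e ≠ 0 := by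
    rcases lt_or_gt_of_ne he with h' | h'
    · rw [(hZ' e).1 h']; decide
    · rw [(hZ' e).2.1 h']; decide
  have := key Z X hZ hX ((hZ' i).2.2 hXi hYi) ((hZ' j).2.2 hXj hYj) hXi hXj
    (fun h0 => hZe (congrFun h0 e)) f hZf
  exact hf (by simp [this, hs f this])

theorem IsOrientedMatroid.exists_cocircuit_of_rank (h : IsOrientedMatroid C)
    (hr : HasChain C 3) (i j : E) : ∃ X ∈ C, X ≠ 0 ∧ X i = 0 ∧ X j = 0 := by
  by_contra! hno
  obtain ⟨c, hc, hlt⟩ := hr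
  have h01 : CovLT (c 0) (c 1) := hlt 0 1 (by decide)
  have h12 : CovLT (c 1) (c 2) := hlt 1 2 (by decide)
  have h23 : CovLT (c 2) (c 3) := hlt 2 3 (by decide)
  have hsupp : ∀ X ∈ C, ∀ Y ∈ C, X i = 0 → Y i = 0 → X ≠ 0 → Y ≠ 0 → ∀ e, X e = 0 → Y e = 0 := by
    intro X hX Y hY hXi hYi hX0 hY0
    have aux : ∀ Y ∈ C, Y i = 0 → Y ≠ 0 → X j = Y j → ∀ e, X e = 0 → Y e = 0 := by
      intro Y hY hYi hY0 hXY e he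
      obtain ⟨Z, hZ, hZj, hZ'⟩ := h.exists_diff hX hY hXY (hno X hX hX0 hXi)
      have hZ0 : Z = 0 := by
        by_contra hZ0
        exact hno Z hZ hZ0 ((hZ' i).2.2 hXi hYi) hZj
      by_contra hYe
      rcases lt_or_gt_of_ne (show X e ≠ Y e from fun h' => hYe (h' ▸ he)) with h' | h'
      · have := (hZ' e).1 h'
        rw [hZ0] at this
        exact absurd this (by rw [Pi.zero_apply]; decide)
      · have := (hZ' e).2.1 h'
        rw [hZ0] at this
        exact absurd this (by rw [Pi.zero_apply]; decide)
    have hx := hno X hX hX0 hXi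
    have hy := hno Y hY hY0 hYi
    have : X j = Y j ∨ X j = (-Y) j := by
      rw [Pi.neg_apply]
      generalize X j = x at *
      generalize Y j = y at *
      clear aux
      revert x y
      decide
    rcases this with h' | h'
    · exact aux Y hY hYi hY0 h'
    · intro e he
      simpa using aux (-Y) (h.2.1 Y hY) (by simp [hYi])
        (fun h0 => hY0 (by rw [← neg_neg Y, h0]; rfl)) h' e he
  have hdiff : ∀ X ∈ C, ∀ Y ∈ C, covLE X Y → X i ≠ 0 → ∃ Z ∈ C, Z i = 0 ∧
      ∀ f, X f = 0 → (Z f = 0 ↔ Y f = 0) := by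
    intro X hX Y hY hle hXi
    obtain ⟨Z, hZ, hZi, hZ'⟩ := h.exists_diff hX hY ((hle i).resolve_left hXi) hXi
    refine ⟨Z, hZ, hZi, fun f hf => ?_⟩
    have := hZ' f
    rw [hf] at this
    generalize Y f = y at *
    generalize Z f = z at *
    clear hf
    revert y z
    decide
  have h1 : c 1 ≠ 0 := by
    intro h0
    obtain ⟨f, _, hf⟩ := h01.exists_zero_ne
    exact hf (congrFun h0 f)
  obtain ⟨f, hf1, hf2⟩ := h12.exists_zero_ne
  obtain ⟨g, hg2, hg3⟩ := h23.exists_zero_ne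
  have hg1 : c 1 g = 0 := by
    rcases h12.1 g with h' | h'
    · exact h'
    · rw [h', hg2]
  by_cases hi2 : c 2 i = 0
  · have hi1 : c 1 i = 0 := by
      rcases h12.1 i with h' | h'
      · exact h'
      · rw [h', hi2]
    exact hf2 (hsupp _ (hc 1) _ (hc 2) hi1 hi2 h1 (fun h0 => hf2 (congrFun h0 f)) f hf1)
  · obtain ⟨Z, hZ, hZi, hZ'⟩ := hdiff _ (hc 2) _ (hc 3) h23.1 hi2
    have hZg : Z g ≠ 0 := fun h0 => hg3 ((hZ' g hg2).1 h0)
    have hZ0 : Z ≠ 0 := fun h0 => hZg (congrFun h0 g)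
    by_cases hi1 : c 1 i = 0
    · exact hZg (hsupp _ (hc 1) _ hZ hi1 hZi h1 hZ0 g hg1)
    · obtain ⟨W, hW, hWi, hW'⟩ := hdiff _ (hc 1) _ (hc 2) h12.1 hi1
      have hWf : W f ≠ 0 := fun h0 => hf2 ((hW' f hf1).1 h0)
      exact hZg (hsupp _ hW _ hZ hWi hZi (fun h0 => hWf (congrFun h0 f)) hZ0 g
        ((hW' g hg1).2 hg2))

theorem exists_not_par_of_rank (hr : HasChain C 3) (i : E) : ∃ j, ¬Par C i j := by
  by_contra! hpar
  obtain ⟨c, hc, hlt⟩ := hr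
  obtain ⟨f, _, hf⟩ := CovLT.exists_zero_ne (hlt 0 1 (by decide))
  obtain ⟨g, hg, _⟩ := CovLT.exists_zero_ne (hlt 1 2 (by decide))
  exact hf (by rw [← hpar f _ (hc 1), hpar g _ (hc 1), hg])

end General

/-- The consequences of having rank `3` that are used below, for an acyclic oriented matroid. -/
structure IsAcyclicRankThree {E : Type*} (C : Set (E → SignType)) : Prop where
  isOrientedMatroid : IsOrientedMatroid C
  one_mem : (fun _ => (1 : SignType)) ∈ C
  eq_or_eq_neg : ∀ {i j : E}, ¬Par C i j → ∀ {X Y : E → SignType}, X ∈ C → Y ∈ C →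
    X i = 0 → X j = 0 → Y i = 0 → Y j = 0 → X ≠ 0 → Y ≠ 0 → X = Y ∨ X = -Y
  exists_cocircuit : ∀ i j : E, ∃ X ∈ C, X ≠ 0 ∧ X i = 0 ∧ X j = 0
  exists_not_par : ∀ i : E, ∃ j, ¬Par C i j

theorem HasRank.isAcyclicRankThree {E : Type*} {C : Set (E → SignType)} (hr : HasRank C 3)
    (h : IsOrientedMatroid C) (h1 : (fun _ => (1 : SignType)) ∈ C) : IsAcyclicRankThree C where
  isOrientedMatroid := h
  one_mem := h1
  eq_or_eq_neg hij _ _ := h.eq_or_eq_neg_of_rank h1 hr.2 hij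
  exists_cocircuit := h.exists_cocircuit_of_rank hr.1
  exists_not_par := exists_not_par_of_rank hr.1

/-- A choice `V i j` of a cocircuit vanishing on `i` and `j`, one from each pair of opposite
cocircuits, and a weak order `pos` of the elements, such that along each element `i` the
cocircuits vanishing there are linearly ordered after reorientation by `pos`. -/
structure SweepData {n : ℕ} (C : Set (Fin n → SignType)) (pos : Fin n → ℕ)
    (V : Fin n → Fin n → Fin n → SignType) : Prop where
  pos_eq : ∀ i j, pos i = pos j ↔ Par C i j
  symm : ∀ i j, V i j = V j i
  mem : ∀ {i j}, ¬Par C i j → V i j ∈ C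
  left : ∀ {i j}, ¬Par C i j → V i j i = 0
  right : ∀ {i j}, ¬Par C i j → V i j j = 0
  ne_zero : ∀ {i j}, ¬Par C i j → V i j ≠ 0
  eq_of_zero : ∀ {i j k}, ¬Par C i j → ¬Par C i k → V i j k = 0 → V i j = V i k
  comparable : ∀ {i j k}, ¬Par C i j → ¬Par C i k →
    (∀ l, (pos i < pos l → V i j l ≤ V i k l) ∧ (pos l < pos i → V i k l ≤ V i j l)) ∨
    (∀ l, (pos i < pos l → V i k l ≤ V i j l) ∧ (pos l < pos i → V i j l ≤ V i k l))

section Slope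

variable {n : ℕ}

open scoped Classical in
/-- The sign vector `Y`, with signs reversed below its first zero, read from the top. -/
noncomputable def slopeKey (pos : Fin n → ℕ) (Y : Fin n → SignType) (k : Fin n) : ℤ :=
  if ∃ j, pos k < pos j ∧ Y j = 0 then -((Y k : SignType) : ℤ) else ((Y k : SignType) : ℤ)

/-- A number encoding the lexicographic order of the keys. -/
noncomputable def slopeVal (pos : Fin n → ℕ) (Y : Fin n → SignType) : ℤ :=
  -∑ k, slopeKey pos Y k * (2 * n + 1 : ℤ) ^ pos k

theorem slopeKey_bound (pos : Fin n → ℕ) (Y : Fin n → SignType) (k : Fin n) :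
    -1 ≤ slopeKey pos Y k ∧ slopeKey pos Y k ≤ 1 := by
  unfold slopeKey
  generalize Y k = y
  split_ifs <;> revert y <;> decide

theorem sum_mul_pow_lt {u v : Fin n → ℤ} {pos : Fin n → ℕ} (hu : ∀ k, -1 ≤ u k ∧ u k ≤ 1)
    (hv : ∀ k, -1 ≤ v k ∧ v k ≤ 1) {m : Fin n} (hm : u m < v m)
    (heq : ∀ k, pos k = pos m → u k ≤ v k) (hgt : ∀ k, pos m < pos k → u k = v k) :
    ∑ k, u k * (2 * n + 1 : ℤ) ^ pos k < ∑ k, v k * (2 * n + 1 : ℤ) ^ pos k := by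
  set D : ℤ := 2 * n + 1 with hD
  have hD1 : 1 ≤ D := by omega
  have hDm : 0 < D ^ pos m := by positivity
  have hterm : ∀ k, -2 * D ^ pos m ≤ D * ((v k - u k) * D ^ pos k) := by
    intro k
    have hDk : 0 < D ^ pos k := by positivity
    rcases lt_trichotomy (pos k) (pos m) with h | h | h
    · have h1 : D * D ^ pos k ≤ D ^ pos m := by
        rw [← pow_succ']
        exact pow_le_pow_right₀ hD1 h
      have h2 : -2 ≤ v k - u k := by linarith [(hu k).2, (hv k).1]
      nlinarith [mul_pos (by omega : 0 < D) hDk]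
    · have h2 : 0 ≤ v k - u k := by linarith [heq k h]
      have : 0 ≤ D * ((v k - u k) * D ^ pos k) := by positivity
      linarith
    · rw [hgt k h]
      simp only [sub_self, zero_mul, mul_zero]
      linarith
  have hsum : (∑ k ∈ Finset.univ.erase m, -2 * D ^ pos m) ≤
      ∑ k ∈ Finset.univ.erase m, D * ((v k - u k) * D ^ pos k) :=
    Finset.sum_le_sum fun k _ => hterm k
  have hmain : D * D ^ pos m ≤ D * ((v m - u m) * D ^ pos m) :=
    mul_le_mul_of_nonneg_left (by nlinarith) (by omega)
  have htot := Finset.add_sum_erase Finset.univ (fun k => D * ((v k - u k) * D ^ pos k))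
    (Finset.mem_univ m)
  have hn : 1 ≤ n := m.pos
  rw [Finset.sum_const, Finset.card_erase_of_mem (Finset.mem_univ m), Finset.card_univ,
    Fintype.card_fin, nsmul_eq_mul, Nat.cast_sub hn] at hsum
  have hpos : 0 < ∑ k, D * ((v k - u k) * D ^ pos k) := by
    push_cast at hsum
    nlinarith
  rw [← Finset.mul_sum] at hpos
  have := (mul_pos_iff_of_pos_left (by omega : 0 < D)).1 hpos
  simp only [sub_mul, Finset.sum_sub_distrib] at this
  linarith

theorem SignType.intCast_lt {x y : SignType} : ((x : SignType) : ℤ) < (y : ℤ) ↔ x < y := by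
  revert x y; decide

variable {C : Set (Fin n → SignType)} {pos : Fin n → ℕ} {V : Fin n → Fin n → Fin n → SignType}

theorem SweepData.slopeVal_lt (h : SweepData C pos V) {i j k : Fin n} (hij : ¬Par C i j)
    (hik : ¬Par C i k) (hne : V i j ≠ V i k)
    (hle : ∀ l, (pos i < pos l → V i k l ≤ V i j l) ∧ (pos l < pos i → V i j l ≤ V i k l)) :
    slopeVal pos (V i j) < slopeVal pos (V i k) := by
  obtain ⟨m, hm, hmax⟩ := Set.exists_max_image {m | V i j m ≠ V i k m} pos (Set.toFinite _)
    (Function.ne_iff.mp hne)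
  have hgt : ∀ l, pos m < pos l → V i j l = V i k l := by
    intro l hl
    by_contra hne
    exact absurd (hmax l hne) (not_le.mpr hl)
  have hpar : ∀ l, pos l = pos m → V i j l = V i j m ∧ V i k l = V i k m := by
    intro l hl
    rw [h.pos_eq] at hl
    exact ⟨hl _ (h.mem hij), hl _ (h.mem hik)⟩
  have hcond : ∀ l, pos m ≤ pos l → ((∃ j', pos l < pos j' ∧ V i k j' = 0) ↔
      ∃ j', pos l < pos j' ∧ V i j j' = 0) := by
    intro l hl
    refine exists_congr fun j' => and_congr_right fun hj' => ?_
    rw [hgt j' (by omega)]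
  unfold slopeVal
  rw [neg_lt_neg_iff]
  have hkm : slopeKey pos (V i k) m < slopeKey pos (V i j) m := by
    unfold slopeKey
    simp only [hcond m le_rfl]
    rcases lt_trichotomy (pos m) (pos i) with hmi | hmi | hmi
    · rw [if_pos ⟨i, hmi, h.left hij⟩, if_pos ⟨i, hmi, h.left hij⟩]
      have := SignType.intCast_lt.mpr (lt_of_le_of_ne ((hle m).2 hmi) hm)
      linarith
    · exact absurd ((hpar i hmi.symm).1.symm.trans ((h.left hij).trans ((h.left hik).symm.trans
        (hpar i hmi.symm).2))) hm
    · have hno : ¬∃ j', pos m < pos j' ∧ V i j j' = 0 := by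
        rintro ⟨j', hj', h0⟩
        have hij' : ¬Par C i j' := fun hp => by
          rw [← h.pos_eq] at hp
          omega
        exact hne ((h.eq_of_zero hij hij' h0).trans
          (h.eq_of_zero hik hij' ((hgt j' hj').symm.trans h0)).symm)
      rw [if_neg hno, if_neg hno]
      exact SignType.intCast_lt.mpr (lt_of_le_of_ne ((hle m).1 hmi) (Ne.symm hm))
  refine sum_mul_pow_lt (slopeKey_bound _ _) (slopeKey_bound _ _) hkm ?_ ?_
  · intro l hl
    have : slopeKey pos (V i k) l = slopeKey pos (V i k) m ∧
        slopeKey pos (V i j) l = slopeKey pos (V i j) m := by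
      simp only [slopeKey, hl, hpar l hl, and_self]
    rw [this.1, this.2]
    exact hkm.le
  · intro l hl
    simp only [slopeKey, hcond l hl.le, hgt l hl]

/-- The slope of a pair of elements. -/
noncomputable def pairSlope (pos : Fin n → ℕ) (V : Fin n → Fin n → Fin n → SignType)
    (i j : Fin n) : ℤ := slopeVal pos (V i j)

theorem SweepData.apply_eq (h : SweepData C pos V) {i j : Fin n} (hij : ¬Par C i j) (k : Fin n) :
    V i j k = SignType.sign (((pos k : ℤ) - pos i) *
        (pairSlope pos V i k - pairSlope pos V i j)) := by
  by_cases hik : Par C i k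
  · rw [← hik _ (h.mem hij), h.left hij, (h.pos_eq i k).2 hik]
    simp
  by_cases heq : V i j = V i k
  · rw [pairSlope, pairSlope, ← heq, heq, h.right hik]
    simp
  have h0 : V i j k ≠ 0 := fun h0 => heq (h.eq_of_zero hij hik h0)
  have hpos : pos i ≠ pos k := fun h' => hik ((h.pos_eq i k).1 h')
  have hk := h.right hik
  rw [sign_mul]
  rcases h.comparable hij hik with hc | hc
  · have hlt := h.slopeVal_lt hik hij (Ne.symm heq) hc
    have := hc k
    rw [hk] at this
    rw [pairSlope, pairSlope, sign_neg (sub_neg.mpr hlt)]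
    rcases lt_or_gt_of_ne hpos with hp | hp
    · rw [sign_pos (by omega)]
      replace this := this.1 hp
      generalize V i j k = y at *
      revert y; decide
    · rw [sign_neg (by omega)]
      replace this := this.2 hp
      generalize V i j k = y at *
      revert y; decide
  · have hlt := h.slopeVal_lt hij hik heq hc
    have := hc k
    rw [hk] at this
    rw [pairSlope, pairSlope, sign_pos (sub_pos.mpr hlt)]
    rcases lt_or_gt_of_ne hpos with hp | hp
    · rw [sign_pos (by omega)]
      replace this := this.1 hp
      generalize V i j k = y at *
      revert y; decide
    · rw [sign_neg (by omega)]
      replace this := this.2 hp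
      generalize V i j k = y at *
      revert y; decide

/-- The covector of the sweep in direction `(α, β)`, extended to all ordered pairs. -/
noncomputable def sweepSign (pos : Fin n → ℕ) (F : Fin n → Fin n → ℤ) (α β : ℤ)
    (i j : Fin n) : SignType :=
  SignType.sign (((pos j : ℤ) - pos i) * (α * F i j + β))

theorem SweepData.pairSlope_symm (h : SweepData C pos V) (i j : Fin n) :
    pairSlope pos V i j = pairSlope pos V j i := by
  rw [pairSlope, pairSlope, h.symm]

theorem SweepData.sweepSign_symm (h : SweepData C pos V) (α β : ℤ) (i j : Fin n) :
    sweepSign pos (pairSlope pos V) α β j i = -sweepSign pos (pairSlope pos V) α β i j := by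
  rw [sweepSign, sweepSign, h.pairSlope_symm j i, ← Left.sign_neg]
  congr 1
  ring

theorem SweepData.sweepSign_of_par (h : SweepData C pos V) (α β : ℤ) {i j : Fin n}
    (hij : Par C i j) : sweepSign pos (pairSlope pos V) α β i j = 0 := by
  rw [sweepSign, (h.pos_eq i j).2 hij]
  simp

theorem SweepData.sweepSign_congr (h : SweepData C pos V) (α β : ℤ) (i : Fin n) {j k : Fin n}
    (hjk : Par C j k) : sweepSign pos (pairSlope pos V) α β i j =
      sweepSign pos (pairSlope pos V) α β i k := by
  by_cases hij : Par C i j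
  · rw [h.sweepSign_of_par α β hij, h.sweepSign_of_par α β (hij.trans hjk)]
  have hik : ¬Par C i k := fun hik => hij (hik.trans hjk.symm)
  have : V i j = V i k := h.eq_of_zero hij hik (by rw [← hjk _ (h.mem hij), h.right hij])
  rw [sweepSign, sweepSign, pairSlope, pairSlope, this, (h.pos_eq j k).2 hjk]

theorem SweepData.pairSlope_mid (h : SweepData C pos V) {i j k : Fin n} (hij : pos i < pos j)
    (hjk : pos j < pos k) :
    (pairSlope pos V i j < pairSlope pos V i k ∧ pairSlope pos V i k < pairSlope pos V j k) ∨
    (pairSlope pos V i j = pairSlope pos V i k ∧ pairSlope pos V i k = pairSlope pos V j k) ∨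
    (pairSlope pos V i k < pairSlope pos V i j ∧ pairSlope pos V j k < pairSlope pos V i k) := by
  have hnp : ∀ {x y}, pos x < pos y → ¬Par C x y := fun hxy hp => by
    rw [← h.pos_eq] at hp; omega
  have e1 := h.apply_eq (hnp hij) k
  have e2 := h.apply_eq (fun hp => hnp hij hp.symm) k
  have e3 := h.apply_eq (hnp (hij.trans hjk)) j
  have e4 := h.apply_eq (fun hp => hnp (hij.trans hjk) hp.symm) j
  rw [h.symm j i, h.pairSlope_symm j i] at e2
  rw [h.symm k i, h.pairSlope_symm k i, h.pairSlope_symm k j] at e4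
  rw [e1, sign_mul, sign_mul, sign_pos (by omega : (0 : ℤ) < (pos k : ℤ) - pos i),
    sign_pos (by omega : (0 : ℤ) < (pos k : ℤ) - pos j), one_mul, one_mul] at e2
  rw [e3, sign_mul, sign_mul, sign_pos (by omega : (0 : ℤ) < (pos j : ℤ) - pos i),
    sign_neg (by omega : (pos j : ℤ) - pos k < 0),
    one_mul, neg_one_mul, ← Left.sign_neg] at e4
  generalize pairSlope pos V i j = a at *
  generalize pairSlope pos V i k = b at *
  generalize pairSlope pos V j k = c at *
  rcases lt_trichotomy a b with hab | hab | hab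
  · rw [sign_neg (by omega : a - b < 0)] at e4
    have := sign_eq_neg_one_iff.mp e4.symm
    omega
  · rw [hab] at e2
    rw [sub_self, sign_zero] at e2
    have := sign_eq_zero_iff.mp e2.symm
    omega
  · rw [sign_pos (by omega : 0 < a - b)] at e4
    have := sign_eq_one_iff.mp e4.symm
    omega

theorem sign_le_sign_iff' {u v : ℤ} :
    SignType.sign u ≤ SignType.sign v ↔ (0 < u → 0 < v) ∧ (0 ≤ u → 0 ≤ v) := by
  have key : ∀ w : ℤ, (w < 0 ∧ SignType.sign w = -1) ∨ (w = 0 ∧ SignType.sign w = 0) ∨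
      (0 < w ∧ SignType.sign w = 1) := fun w => by
    rcases lt_trichotomy w 0 with hw | hw | hw
    · exact Or.inl ⟨hw, sign_neg hw⟩
    · exact Or.inr (Or.inl ⟨hw, by rw [hw, sign_zero]⟩)
    · exact Or.inr (Or.inr ⟨hw, sign_pos hw⟩)
  rcases key u with ⟨hu, eu⟩ | ⟨hu, eu⟩ | ⟨hu, eu⟩ <;>
    rcases key v with ⟨hv, ev⟩ | ⟨hv, ev⟩ | ⟨hv, ev⟩ <;> rw [eu, ev] <;>
    simp only [show ((-1 : SignType) ≤ 0) = True by decide,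
      show ((-1 : SignType) ≤ 1) = True by decide, show ((0 : SignType) ≤ 1) = True by decide,
      show ((0 : SignType) ≤ -1) = False by decide, show ((1 : SignType) ≤ -1) = False by decide,
      show ((1 : SignType) ≤ 0) = False by decide, le_refl, true_iff, false_iff] <;> omega

theorem sweepSign_of_lt {F : Fin n → Fin n → ℤ} {α β : ℤ} {i j : Fin n}
    (hij : pos i < pos j) : sweepSign pos F α β i j = SignType.sign (α * F i j + β) := by
  rw [sweepSign, sign_mul, sign_pos (by omega), one_mul]

theorem SweepData.sweepSign_of_gt (h : SweepData C pos V) {α β : ℤ} {i j : Fin n}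
    (hij : pos j < pos i) : sweepSign pos (pairSlope pos V) α β i j =
      SignType.sign (-(α * pairSlope pos V j i + β)) := by
  rw [h.sweepSign_symm, sweepSign_of_lt hij, Left.sign_neg]

theorem SweepData.sweepSign_mid (h : SweepData C pos V) (α β : ℤ) {i j k : Fin n}
    (hij : pos i < pos j) (hjk : pos j < pos k) : ∃ a b c : ℤ,
      ((a < b ∧ b < c) ∨ (a = b ∧ b = c) ∨ (b < a ∧ c < b)) ∧
      a = α * pairSlope pos V i j + β ∧
      b = α * pairSlope pos V i k + β ∧ c = α * pairSlope pos V j k + β := by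
  refine ⟨_, _, _, ?_, rfl, rfl, rfl⟩
  have := h.pairSlope_mid hij hjk
  generalize pairSlope pos V i j = a at *
  generalize pairSlope pos V i k = b at *
  generalize pairSlope pos V j k = c at *
  rcases lt_trichotomy α 0 with hα | hα | hα
  · rcases this with ⟨h1, h2⟩ | ⟨h1, h2⟩ | ⟨h1, h2⟩
    · right; right; constructor <;> nlinarith
    · right; left; subst h1 h2; simp
    · left; constructor <;> nlinarith
  · right; left; simp [hα]
  · rcases this with ⟨h1, h2⟩ | ⟨h1, h2⟩ | ⟨h1, h2⟩
    · left; constructor <;> nlinarith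
    · right; left; subst h1 h2; simp
    · right; right; constructor <;> nlinarith

theorem SweepData.sweepSign_mono (h : SweepData C pos V) (α β : ℤ) {i j : Fin n}
    (hij : 0 ≤ sweepSign pos (pairSlope pos V) α β i j) (k : Fin n) :
    sweepSign pos (pairSlope pos V) α β k i ≤ sweepSign pos (pairSlope pos V) α β k j := by
  by_cases pij : Par C i j
  · exact (h.sweepSign_congr α β k pij).le
  by_cases pik : Par C i k
  · rw [h.sweepSign_of_par α β pik.symm, h.sweepSign_symm α β j k,
      ← h.sweepSign_congr α β j pik, ← h.sweepSign_symm]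
    exact hij
  by_cases pjk : Par C j k
  · rw [h.sweepSign_of_par α β pjk.symm, h.sweepSign_symm α β i k,
      ← h.sweepSign_congr α β i pjk]
    generalize sweepSign pos (pairSlope pos V) α β i j = x at *
    revert x; decide
  rw [← h.pos_eq] at pij pik pjk
  rw [← sign_zero (α := ℤ)] at hij
  rcases lt_or_gt_of_ne pij with hp1 | hp1 <;> rcases lt_or_gt_of_ne pik with hp2 | hp2 <;>
    rcases lt_or_gt_of_ne pjk with hp3 | hp3 <;> try omega
  · obtain ⟨a, b, c, hh, ea, eb, ec⟩ := h.sweepSign_mid α β hp1 hp3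
    rw [sweepSign_of_lt hp1, ← ea, sign_le_sign_iff'] at hij
    rw [h.sweepSign_of_gt hp2, h.sweepSign_of_gt hp3, ← eb, ← ec, sign_le_sign_iff']
    omega
  · obtain ⟨a, b, c, hh, ea, eb, ec⟩ := h.sweepSign_mid α β hp2 hp3
    rw [sweepSign_of_lt hp1, ← eb, sign_le_sign_iff'] at hij
    rw [h.sweepSign_of_gt hp2, sweepSign_of_lt hp3, ← ea, ← ec, sign_le_sign_iff']
    omega
  · obtain ⟨a, b, c, hh, ea, eb, ec⟩ := h.sweepSign_mid α β hp2 hp1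
    rw [sweepSign_of_lt hp1, ← ec, sign_le_sign_iff'] at hij
    rw [sweepSign_of_lt hp2, sweepSign_of_lt hp3, ← ea, ← eb, sign_le_sign_iff']
    omega
  · obtain ⟨a, b, c, hh, ea, eb, ec⟩ := h.sweepSign_mid α β hp1 hp2
    rw [h.sweepSign_of_gt hp1, ← ea, sign_le_sign_iff'] at hij
    rw [h.sweepSign_of_gt hp2, h.sweepSign_of_gt hp3, ← eb, ← ec, sign_le_sign_iff']
    omega
  · obtain ⟨a, b, c, hh, ea, eb, ec⟩ := h.sweepSign_mid α β hp3 hp2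
    rw [h.sweepSign_of_gt hp1, ← eb, sign_le_sign_iff'] at hij
    rw [sweepSign_of_lt hp2, h.sweepSign_of_gt hp3, ← ea, ← ec, sign_le_sign_iff']
    omega
  · obtain ⟨a, b, c, hh, ea, eb, ec⟩ := h.sweepSign_mid α β hp3 hp1
    rw [h.sweepSign_of_gt hp1, ← ec, sign_le_sign_iff'] at hij
    rw [sweepSign_of_lt hp2, sweepSign_of_lt hp3, ← ea, ← eb, sign_le_sign_iff']
    omega

theorem signComp_sign_mul {E : Type*} {p u v w : E → ℤ}
    (h : ∀ k, p k ≠ 0 → (0 < u k ∧ 0 < w k) ∨ (u k < 0 ∧ w k < 0) ∨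
      (u k = 0 ∧ ((0 < v k ∧ 0 < w k) ∨ (v k < 0 ∧ w k < 0)))) :
    (fun k => SignType.sign (p k * w k)) =
      signComp (fun k => SignType.sign (p k * u k)) (fun k => SignType.sign (p k * v k)) := by
  funext k
  by_cases hk : p k = 0
  · simp [signComp, hk]
  have hs : SignType.sign (p k) ≠ 0 := by simpa using hk
  rcases h k hk with ⟨h1, h2⟩ | ⟨h1, h2⟩ | ⟨h1, ⟨h2, h3⟩ | ⟨h2, h3⟩⟩ <;>
    simp [signComp, sign_mul, *]

theorem sign_mul_mem (hC : IsAcyclicRankThree C) (h : SweepData C pos V) {i : Fin n}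
    {φ : Fin n → ℤ} (hφ : ∀ j, ¬Par C i j →
      (fun k => SignType.sign (((pos k : ℤ) - pos i) * (φ k - φ j))) ∈ C)
    (hne : ∃ j k, ¬Par C i j ∧ ¬Par C i k ∧ φ j ≠ φ k) (h0 : ∀ j, ¬Par C i j → φ j ≠ 0) :
    (fun k => SignType.sign (((pos k : ℤ) - pos i) * φ k)) ∈ C := by
  have hO := hC.isOrientedMatroid
  have hp : ∀ k, (pos k : ℤ) - pos i ≠ 0 → ¬Par C i k := fun k hk hik => by
    rw [← h.pos_eq] at hik; omega
  have hpos : ∀ ψ : Fin n → ℤ, (∀ j, ¬Par C i j →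
      (fun k => SignType.sign (((pos k : ℤ) - pos i) * (ψ k - ψ j))) ∈ C) →
      (∃ j k, ¬Par C i j ∧ ¬Par C i k ∧ ψ j ≠ ψ k) → (∀ j, ¬Par C i j → 0 < ψ j) →
      (fun k => SignType.sign (((pos k : ℤ) - pos i) * ψ k)) ∈ C := by
    intro ψ hψ ⟨j, k, hj, hk, hjk⟩ hψ0
    obtain ⟨a, ha, hamin⟩ := Set.exists_min_image {j | ¬Par C i j} ψ (Set.toFinite _) ⟨j, hj⟩
    obtain ⟨b, hb, hbmax⟩ := Set.exists_max_image {j | ¬Par C i j} ψ (Set.toFinite _) ⟨j, hj⟩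
    have hab : ψ a < ψ b := by
      have := hamin j hj; have := hamin k hk; have := hbmax j hj; have := hbmax k hk
      omega
    have hb' : (fun k => SignType.sign (((pos k : ℤ) - pos i) * (ψ b - ψ k))) ∈ C := by
      convert hO.2.1 _ (hψ b hb) using 1
      funext k
      rw [Pi.neg_apply, ← Left.sign_neg]
      congr 1; ring
    have := hO.2.2.1 _ (hψ a ha) _ hb'
    rwa [← signComp_sign_mul (w := ψ)] at this
    intro k hk
    have h1 := hamin k (hp k hk)
    have h2 := hbmax k (hp k hk)
    have h3 := hψ0 k (hp k hk)
    omega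
  by_cases hlow : ∀ j, ¬Par C i j → 0 < φ j
  · exact hpos φ hφ hne hlow
  by_cases hhigh : ∀ j, ¬Par C i j → φ j < 0
  · have := hO.2.1 _ (hpos (fun k => -φ k) (fun j hj => by
      convert hO.2.1 _ (hφ j hj) using 1
      funext k
      rw [Pi.neg_apply, ← Left.sign_neg]
      congr 1; ring) (by simpa using hne) (fun j hj => by simpa using hhigh j hj))
    convert this using 1
    funext k
    rw [Pi.neg_apply, ← Left.sign_neg]
    congr 1; ring
  push Not at hlow hhigh
  obtain ⟨a, ⟨ha, ha0⟩, hamax⟩ := Set.exists_max_image {j | ¬Par C i j ∧ φ j < 0} φ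
    (Set.toFinite _) (by
      obtain ⟨j, hj, hj'⟩ := hlow
      exact ⟨j, hj, lt_of_le_of_ne hj' (h0 j hj)⟩)
  obtain ⟨b, ⟨hb, hb0⟩, hbmin⟩ := Set.exists_min_image {j | ¬Par C i j ∧ 0 < φ j} φ
    (Set.toFinite _) (by
      obtain ⟨j, hj, hj'⟩ := hhigh
      exact ⟨j, hj, lt_of_le_of_ne hj' (h0 j hj).symm⟩)
  have := hO.2.2.1 _ (hφ a ha) _ (hφ b hb)
  rwa [← signComp_sign_mul (w := φ)] at this
  intro k hk
  have h1 := hamax k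
  have h2 := hbmin k
  have h3 := h0 k (hp k hk)
  have h4 := hp k hk
  simp only [Set.mem_ofPred_eq, h4, not_false_eq_true, true_and] at h1 h2
  omega

theorem SweepData.exists_ne (hC : IsAcyclicRankThree C) (h : SweepData C pos V) (i : Fin n) :
    ∃ j k, ¬Par C i j ∧ ¬Par C i k ∧ pairSlope pos V i j ≠ pairSlope pos V i k := by
  obtain ⟨j, hj⟩ := hC.exists_not_par i
  obtain ⟨k, hk⟩ := Function.ne_iff.mp (h.ne_zero hj)
  refine ⟨j, k, hj, fun hp => hk ?_, fun he => hk ?_⟩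
  · rw [← hp _ (h.mem hj), h.left hj]; rfl
  · rw [h.apply_eq hj, he, sub_self, mul_zero, sign_zero]; rfl

theorem SweepData.sweepSign_mem (hC : IsAcyclicRankThree C) (h : SweepData C pos V) (α β : ℤ)
    (i : Fin n) : sweepSign pos (pairSlope pos V) α β i ∈ C := by
  have hO := hC.isOrientedMatroid
  have hshift : ∀ α β : ℤ, ∀ j, ¬Par C i j → (fun k => SignType.sign (((pos k : ℤ) - pos i) *
      ((α * pairSlope pos V i k + β) - (α * pairSlope pos V i j + β)))) ∈ C := by
    intro α β j hj
    have e : (fun k => SignType.sign (((pos k : ℤ) - pos i) *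
      ((α * pairSlope pos V i k + β) - (α * pairSlope pos V i j + β)))) =
      fun k => SignType.sign α * V i j k := by
      funext k
      rw [h.apply_eq hj, ← sign_mul]
      congr 1; ring
    rw [e]
    rcases lt_trichotomy α 0 with hα | hα | hα
    · convert hO.2.1 _ (h.mem hj) using 1
      funext k
      rw [sign_neg hα, neg_one_mul, Pi.neg_apply]
    · simpa [hα] using hO.1
    · simpa only [sign_pos hα, one_mul] using h.mem hj
  have hne := h.exists_ne hC i
  have hconst : (fun k => SignType.sign ((pos k : ℤ) - pos i)) ∈ C := by
    obtain ⟨m, hm, hmin⟩ := Set.exists_min_image {j | ¬Par C i j} (pairSlope pos V i)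
      (Set.toFinite _) (hC.exists_not_par i)
    have hpos : ∀ j, ¬Par C i j → 0 < 1 * pairSlope pos V i j + (1 - pairSlope pos V i m) :=
      fun j hj => by
        have := hmin j hj
        omega
    have := sign_mul_mem hC h (hshift 1 (1 - pairSlope pos V i m)) (by simpa using hne)
      (fun j hj => (hpos j hj).ne')
    convert this using 1
    funext k
    by_cases hk : Par C i k
    · simp [(h.pos_eq i k).2 hk]
    · rw [sign_mul, sign_pos (hpos k hk), mul_one]
  by_cases h0 : ∃ j, ¬Par C i j ∧ α * pairSlope pos V i j + β = 0
  · obtain ⟨j, hj, hj0⟩ := h0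
    have := hshift α β j hj
    simp only [hj0, sub_zero] at this
    exact this
  push Not at h0
  by_cases hα : α = 0
  · have e : sweepSign pos (pairSlope pos V) α β i =
        fun k => SignType.sign ((pos k : ℤ) - pos i) * SignType.sign β := by
      funext k
      rw [sweepSign, hα, zero_mul, zero_add, sign_mul]
    rw [e]
    rcases lt_trichotomy β 0 with hβ | hβ | hβ
    · convert hO.2.1 _ hconst using 1
      funext k
      rw [sign_neg hβ, mul_neg_one, Pi.neg_apply]
    · simpa [hβ] using hO.1
    · simpa only [sign_pos hβ, mul_one] using hconst
  · exact sign_mul_mem hC h (hshift α β) (by simpa [hα] using hne) h0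

theorem IsOrientedMatroid.contraction {E : Type*} {C : Set (E → SignType)}
    (h : IsOrientedMatroid C) (i : E) : IsOrientedMatroid {X | X ∈ C ∧ X i = 0} := by
  refine ⟨⟨h.1, rfl⟩, fun X hX => ⟨h.2.1 X hX.1, by simp [hX.2]⟩,
    fun X hX Y hY => ⟨h.2.2.1 X hX.1 Y hY.1, by simp [signComp, hX.2, hY.2]⟩,
    fun X hX Y hY e he hXY => ?_⟩
  obtain ⟨Z, hZ, hZe, hZf⟩ := h.2.2.2 X hX.1 Y hY.1 e he hXY
  refine ⟨Z, ⟨hZ, ?_⟩, hZe, hZf⟩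
  rw [hZf i (by simp [hX.2]), signComp, if_pos hX.2, hY.2]

theorem SweepData.eq_sweepSign (hC : IsAcyclicRankThree C) (h : SweepData C pos V)
    {X : Fin n → SignType} (hX : X ∈ C) {i : Fin n} (hi : X i = 0) (hX0 : X ≠ 0) :
    ∃ α β : ℤ, X = sweepSign pos (pairSlope pos V) α β i := by
  have hV : ∀ {j}, ¬Par C i j → ∀ Z ∈ C, Z i = 0 → Z j = 0 →
      ∃ δ : ℤ, ∀ k, Z k =
        SignType.sign (((pos k : ℤ) - pos i) *
          (δ * (pairSlope pos V i k - pairSlope pos V i j))) := by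
    intro j hj Z hZ hZi hZj
    by_cases hZ0 : Z = 0
    · exact ⟨0, fun k => by simp [hZ0]⟩
    rcases hC.eq_or_eq_neg hj hZ (h.mem hj) hZi hZj (h.left hj) (h.right hj) hZ0
      (h.ne_zero hj) with e | e
    · exact ⟨1, fun k => by rw [e, h.apply_eq hj, one_mul]⟩
    · refine ⟨-1, fun k => ?_⟩
      rw [e, Pi.neg_apply, h.apply_eq hj, ← Left.sign_neg]
      congr 1; ring
  by_cases hz : ∃ j, ¬Par C i j ∧ X j = 0
  · obtain ⟨j, hj, hXj⟩ := hz
    obtain ⟨δ, hδ⟩ := hV hj X hX hi hXj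
    refine ⟨δ, -δ * pairSlope pos V i j, funext fun k => ?_⟩
    rw [hδ, sweepSign]
    congr 1; ring
  push Not at hz
  have hpar : ∀ k, X k = 0 → Par C i k := fun k hk => by
    by_contra hp
    exact hz k hp hk
  have hL := hC.isOrientedMatroid.contraction i
  obtain ⟨j, hXj, Z, ⟨hZ, hZi⟩, hZj, hZk⟩ := hL.exists_facet (X := X) (Y := -X) ⟨hX, hi⟩
    (hL.2.1 X ⟨hX, hi⟩)
    (fun e => hX0 (funext fun k => by
      have := congrFun e k
      rw [Pi.neg_apply] at this
      rw [Pi.zero_apply]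
      generalize X k = x at *
      revert x; decide))
    (fun W hW k hk => by rw [← hpar k hk W hW.1, hW.2]) (fun k => Or.inr rfl)
  have hj : ¬Par C i j := fun hp => hXj (by rw [← hp X hX, hi])
  obtain ⟨δ, hδ⟩ := hV hj Z hZ hZi hZj
  obtain ⟨ε, hε, hε'⟩ : ∃ ε : ℤ, (ε = 1 ∨ ε = -1) ∧
      SignType.sign ((pos j : ℤ) - pos i) * X j = SignType.sign ε := by
    have : SignType.sign ((pos j : ℤ) - pos i) * X j ≠ 0 := by
      rw [← h.pos_eq] at hj
      exact mul_ne_zero (by rw [Ne, sign_eq_zero_iff]; omega) hXj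
    generalize SignType.sign ((pos j : ℤ) - pos i) * X j = x at *
    clear * - this
    rcases x with _ | _ | _
    · exact absurd rfl this
    · exact ⟨-1, Or.inr rfl, rfl⟩
    · exact ⟨1, Or.inl rfl, rfl⟩
  refine ⟨2 * δ, ε - 2 * δ * pairSlope pos V i j, funext fun k => ?_⟩
  by_cases hk : Par C i k
  · rw [h.sweepSign_of_par _ _ hk, ← hk X hX, hi]
  have hpos : SignType.sign ((pos k : ℤ) - pos i) ≠ 0 := by
    rw [← h.pos_eq] at hk
    rw [Ne, sign_eq_zero_iff]
    omega
  have e : 2 * δ * pairSlope pos V i k + (ε - 2 * δ * pairSlope pos V i j) =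
      2 * (δ * (pairSlope pos V i k - pairSlope pos V i j)) + ε := by ring
  have hδk := hδ k
  rw [sweepSign, e, sign_mul]
  rw [sign_mul] at hδk
  generalize δ * (pairSlope pos V i k - pairSlope pos V i j) = d at *
  have hd : d ≠ 0 → SignType.sign (2 * d + ε) = SignType.sign d := by
    intro hd
    rcases lt_or_gt_of_ne hd with hd | hd
    · rw [sign_neg hd, sign_neg (by omega)]
    · rw [sign_pos hd, sign_pos (by omega)]
  rcases hZk k with h1 | ⟨h1, -, h2⟩
  · rw [h1] at hδk
    rw [hd, hδk]
    rintro rfl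
    exact hz k hk (by rw [hδk, sign_zero, mul_zero])
  · rw [h1, eq_comm, mul_eq_zero, or_iff_right hpos, sign_eq_zero_iff] at hδk
    have h3 := h2 (fun l => SignType.sign ((pos l : ℤ) - pos i))
      ⟨by
        have := h.sweepSign_mem hC 0 1 i
        unfold sweepSign at this
        simpa only [zero_mul, zero_add, mul_one] using this, by simp⟩
    have h4 : SignType.sign ((pos j : ℤ) - pos i) ≠ 0 := by
      rw [← h.pos_eq] at hj
      rw [Ne, sign_eq_zero_iff]
      omega
    rw [hδk, mul_zero, zero_add, ← hε', mul_left_comm, h3]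
    generalize SignType.sign ((pos j : ℤ) - pos i) = z at *
    generalize X k = w at *
    clear * - h4
    revert z w; decide

/-- The sign vectors of the elements of a group of integer vectors form an oriented matroid. -/
theorem isOrientedMatroid_sign {E : Type*} [Fintype E] (S : AddSubgroup (E → ℤ)) :
    IsOrientedMatroid {X : E → SignType | ∃ u ∈ S, ∀ e, X e = SignType.sign (u e)} := by
  refine ⟨⟨0, S.zero_mem, by simp⟩, ?_, ?_, ?_⟩
  · rintro X ⟨u, hu, hX⟩
    exact ⟨-u, S.neg_mem hu, fun e => by simp [hX, Left.sign_neg]⟩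
  · rintro X ⟨u, hu, hX⟩ Y ⟨v, hv, hY⟩
    refine ⟨(1 + ∑ e, |v e|) • u + v, S.add_mem (S.zsmul_mem hu _) hv, fun e => ?_⟩
    have hN : |v e| < 1 + ∑ e, |v e| := by
      have : |v e| ≤ ∑ e, |v e| := Finset.single_le_sum (f := fun e => |v e|)
        (fun e _ => abs_nonneg _) (Finset.mem_univ e)
      omega
    obtain ⟨h1, h2⟩ := abs_lt.1 hN
    simp only [signComp, hX, hY, Pi.add_apply, Pi.smul_apply, smul_eq_mul]
    rcases lt_trichotomy (u e) 0 with hu | hu | hu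
    · rw [sign_neg hu, if_neg (by decide), sign_neg (by nlinarith)]
    · simp [hu]
    · rw [sign_pos hu, if_neg (by decide), sign_pos (by nlinarith)]
  · rintro X ⟨u, hu, hX⟩ Y ⟨v, hv, hY⟩ e he heq
    have h0 : |v e| * u e + |u e| * v e = 0 ∧ 0 < |v e| ∧ 0 < |u e| := by
      rw [hX] at he heq
      rw [hY] at heq
      rcases lt_trichotomy (u e) 0 with hu | hu | hu
      · rw [sign_neg hu, neg_inj, eq_comm, sign_eq_one_iff] at heq
        rw [abs_of_neg hu, abs_of_pos heq]
        exact ⟨by ring, by omega, by omega⟩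
      · simp [hu] at he
      · rw [sign_pos hu, ← Left.sign_neg, eq_comm, sign_eq_one_iff] at heq
        rw [abs_of_pos hu, abs_of_neg (by omega)]
        exact ⟨by ring, by omega, by omega⟩
    obtain ⟨h0, hv0, hu0⟩ := h0
    refine ⟨_, ⟨|v e| • u + |u e| • v, S.add_mem (S.zsmul_mem hu _) (S.zsmul_mem hv _),
      fun _ => rfl⟩, by simp [h0], fun f hf => ?_⟩
    simp only [signComp, hX, hY, Pi.add_apply, Pi.smul_apply, smul_eq_mul] at hf ⊢
    rcases lt_trichotomy (u f) 0 with hu | hu | hu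
    · have : v f ≤ 0 := by
        by_contra! hv
        exact hf (by rw [sign_neg hu, sign_pos hv]; decide)
      rw [sign_neg hu, if_neg (by decide), sign_neg (by nlinarith)]
    · simp only [hu, mul_zero, zero_add, sign_zero, if_true, sign_mul, sign_pos hu0, one_mul]
    · have : 0 ≤ v f := by
        by_contra! hv
        exact hf (by rw [sign_neg hv, sign_pos hu]; decide)
      rw [sign_pos hu, if_neg (by decide), sign_pos (by nlinarith)]

theorem exists_surjective_lt_iff (f : Fin n → ℤ) :
    ∃ (l : ℕ) (p : Fin n → Fin l), Function.Surjective p ∧ ∀ i j, p i < p j ↔ f i < f j := by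
  have hmem : ∀ i, f i ∈ Finset.univ.image f := fun i =>
    Finset.mem_image_of_mem f (Finset.mem_univ i)
  refine ⟨_, fun i => ((Finset.univ.image f).orderIsoOfFin rfl).symm ⟨f i, hmem i⟩, ?_, ?_⟩
  · intro y
    obtain ⟨i, -, hi⟩ := Finset.mem_image.1 (((Finset.univ.image f).orderIsoOfFin rfl) y).2
    refine ⟨i, ?_⟩
    rw [OrderIso.symm_apply_eq]
    exact Subtype.ext hi
  · intro i j
    simp

/-- The sweep oriented matroid of the slopes `F`. -/
def sweepCovectors (pos : Fin n → ℕ) (F : Fin n → Fin n → ℤ) : Set (Pairs n → SignType) :=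
  {X | ∃ α β : ℤ, ∀ e, X e = sweepSign pos F α β e.1.1 e.1.2}

theorem isOrientedMatroid_sweepCovectors (pos : Fin n → ℕ) (F : Fin n → Fin n → ℤ) :
    IsOrientedMatroid (sweepCovectors pos F) := by
  let S : AddSubgroup (Pairs n → ℤ) :=
    { carrier := {u | ∃ α β : ℤ, ∀ e, u e =
        ((pos e.1.2 : ℤ) - pos e.1.1) * (α * F e.1.1 e.1.2 + β)}
      zero_mem' := ⟨0, 0, by simp⟩
      add_mem' := by
        rintro u v ⟨α, β, hu⟩ ⟨α', β', hv⟩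
        exact ⟨α + α', β + β', fun e => by rw [Pi.add_apply, hu, hv]; ring⟩
      neg_mem' := by
        rintro u ⟨α, β, hu⟩
        exact ⟨-α, -β, fun e => by rw [Pi.neg_apply, hu]; ring⟩ }
  convert isOrientedMatroid_sign S using 1
  ext X
  constructor
  · rintro ⟨α, β, hX⟩
    exact ⟨_, ⟨α, β, fun e => rfl⟩, hX⟩
  · rintro ⟨u, ⟨α, β, hu⟩, hX⟩
    exact ⟨α, β, fun e => by rw [hX, hu]; rfl⟩

theorem SweepData.exists_surjective (h : SweepData C pos V) (α β : ℤ) :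
    ∃ (l : ℕ) (p : Fin n → Fin l), Function.Surjective p ∧
      ∀ i j, sweepSign pos (pairSlope pos V) α β i j =
        if p i < p j then 1 else if p j < p i then -1 else 0 := by
  have hmono := fun i j => h.sweepSign_mono α β (i := i) (j := j)
  have hsymm := h.sweepSign_symm α β
  generalize sweepSign pos (pairSlope pos V) α β = R at *
  have hzero : ∀ i, R i i = 0 := by
    intro i
    have := hsymm i i
    generalize R i i = x at *
    clear * - this
    revert x; decide
  have hle : ∀ i j, 0 ≤ R i j → ∑ k, (R k i : ℤ) ≤ ∑ k, (R k j : ℤ) := fun i j hij =>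
    Finset.sum_le_sum fun k _ => not_lt.1 (mt SignType.intCast_lt.1 (not_lt.2 (hmono i j hij k)))
  have hlt : ∀ i j, R i j = 1 → ∑ k, (R k i : ℤ) < ∑ k, (R k j : ℤ) := fun i j hij =>
    Finset.sum_lt_sum (fun k _ => not_lt.1 (mt SignType.intCast_lt.1
        (not_lt.2 (hmono i j (by rw [hij]; decide) k))))
      ⟨i, Finset.mem_univ i, SignType.intCast_lt.2 (by rw [hij, hzero]; decide)⟩
  obtain ⟨l, p, hp, hpf⟩ := exists_surjective_lt_iff fun i => ∑ k, (R k i : ℤ)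
  refine ⟨l, p, hp, fun i j => ?_⟩
  simp only [hpf]
  have h1 := hle i j
  have h2 := hle j i
  have h3 := hlt i j
  have h4 := hlt j i
  rw [hsymm i j] at h2 h4
  generalize R i j = x at *
  rcases x with _ | _ | _
  · rw [if_neg (h1 (by decide)).not_gt, if_neg (h2 (by decide)).not_gt]
    rfl
  · have := h4 (by decide)
    rw [if_neg this.not_gt, if_pos this]
    rfl
  · rw [if_pos (h3 rfl)]
    rfl

theorem SweepData.littleCovectors_eq (hC : IsAcyclicRankThree C) (h : SweepData C pos V) :
    LittleCovectors (sweepCovectors pos (pairSlope pos V)) = C := by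
  have hO := hC.isOrientedMatroid
  ext Y
  constructor
  · rintro ⟨Z, ⟨X, ⟨α, β, hX⟩, l, p, hp, hXp, k, hk1, hkl, hZ, -⟩, hY⟩
    have hR : ∀ i j, sweepSign pos (pairSlope pos V) α β i j =
        if p i < p j then 1 else if p j < p i then -1 else 0 := by
      intro i j
      rcases lt_trichotomy i j with hij | hij | hij
      · rw [← hX ⟨(i, j), hij⟩, hXp]
      · subst hij
        simp [sweepSign]
      · rw [h.sweepSign_symm, ← hX ⟨(j, i), hij⟩, hXp]
        rcases lt_trichotomy (p i) (p j) with hp | hp | hp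
        · simp [hp, hp.not_gt]
        · simp [hp]
        · simp [hp, hp.not_gt]
    have hmem := h.sweepSign_mem hC α β
    rcases Nat.even_or_odd' k with ⟨m, rfl | rfl⟩
    · obtain ⟨i, hi⟩ := hp ⟨m - 1, by omega⟩
      convert hmem i using 1
      funext j
      rw [hY, hZ, hR, hi]
      simp only [Fin.lt_def]
      split_ifs <;> first | rfl | omega
    · rcases Nat.eq_zero_or_pos m with rfl | hm
      · convert hC.one_mem using 1
        funext j
        rw [hY, hZ]
        simp
      · obtain ⟨i, hi⟩ := hp ⟨m - 1, by omega⟩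
        convert hO.2.2.1 _ (hmem i) _ (hO.2.1 _ hC.one_mem) using 1
        funext j
        rw [hY, hZ, signComp, hR, hi]
        simp only [Fin.lt_def, Pi.neg_apply]
        split_ifs <;> first | rfl | omega | contradiction
  · intro hY
    have key : ∀ α β : ℤ, ∃ (l : ℕ) (p : Fin n → Fin l), (∀ i j,
        sweepSign pos (pairSlope pos V) α β i j =
          if p i < p j then 1 else if p j < p i then -1 else 0) ∧
        ∀ k, 1 ≤ k → k ≤ 2 * l + 1 → (∀ i, Y i = if (p i : ℕ) + 1 ≤ (k - 1) / 2 then -1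
          else if k / 2 < (p i : ℕ) + 1 then 1 else 0) →
          Y ∈ LittleCovectors (sweepCovectors pos (pairSlope pos V)) := by
      intro α β
      obtain ⟨l, p, hp, hR⟩ := h.exists_surjective α β
      refine ⟨l, p, hR, fun k hk1 hkl hYk => ⟨Sum.elim Y fun e =>
        sweepSign pos (pairSlope pos V) α β e.1.1 e.1.2, ⟨_, ⟨α, β, fun e => rfl⟩, l, p, hp,
        fun e => hR _ _, k, hk1, hkl, hYk, fun e => rfl⟩, fun i => rfl⟩⟩
    have hrow : ∀ Z ∈ C, ∀ i, Z i = 0 → ∃ α β : ℤ, Z = sweepSign pos (pairSlope pos V) α β i := by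
      intro Z hZ i hi
      by_cases h0 : Z = 0
      · exact ⟨0, 0, by funext j; simp [sweepSign, h0]⟩
      · exact h.eq_sweepSign hC hZ hi h0
    by_cases h1 : Y = fun _ => 1
    · obtain ⟨l, p, -, hp⟩ := key 0 0
      exact hp 1 le_rfl (by omega) fun i => by simp [h1]
    by_cases hz : ∃ i, Y i = 0
    · obtain ⟨i, hi⟩ := hz
      obtain ⟨α, β, hYi⟩ := hrow Y hY i hi
      obtain ⟨l, p, hR, hp⟩ := key α β
      refine hp (2 * (p i + 1)) (by omega) (by have := (p i).2; omega) fun j => ?_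
      rw [hYi, hR]
      simp only [Fin.lt_def]
      split_ifs <;> first | rfl | omega
    · push Not at hz
      obtain ⟨i, hi, Z, hZ, hZi, hZk⟩ := hO.exists_facet hY hC.one_mem (Ne.symm h1)
        (fun W _ k hk => absurd hk (hz k)) (fun k => by
          have := hz k
          generalize Y k = y at *
          clear * - this
          revert y; decide)
      obtain ⟨α, β, hZR⟩ := hrow Z hZ i hZi
      obtain ⟨l, p, hR, hp⟩ := key α β
      refine hp (2 * (p i + 1) + 1) (by omega) (by have := (p i).2; omega) fun j => ?_
      have hYj : Y j = signComp Z (fun _ => -1) j := by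
        rcases hZk j with e | ⟨e, e', -⟩
        · rw [signComp, e, if_neg (hz j)]
        · rw [signComp, if_pos e, e', neg_neg]
      rw [hYj, signComp, hZR, hR]
      simp only [Fin.lt_def]
      split_ifs <;> first | rfl | omega | contradiction

theorem SweepData.isBraidCovector (h : SweepData C pos V) {X : Pairs n → SignType}
    (hX : X ∈ sweepCovectors pos (pairSlope pos V)) : IsBraidCovector X := by
  obtain ⟨α, β, hX⟩ := hX
  obtain ⟨l, p, hp, hR⟩ := h.exists_surjective α β
  exact ⟨l, p, hp, fun e => (hX e).trans (hR _ _)⟩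

end Slope

section Flag

variable {E : Type*} {C : Set (E → SignType)} {a b c : E} {S T : E → SignType}

/-- A facet `S` of the positive tope, vanishing at `a`, and a facet `T` of `S`, vanishing at `a`
and `b` and positive at `c`. -/
structure IsPositiveFlag (C : Set (E → SignType)) (a b c : E) (S T : E → SignType) : Prop where
  left_mem : S ∈ C
  left_apex : S a = 0
  left_eq_one : ∀ {k}, ¬Par C a k → S k = 1
  not_par : ¬Par C a b
  right_mem : T ∈ C
  right_apex : T a = 0
  right_edge : T b = 0
  right_nonneg : ∀ k, 0 ≤ T k
  right_eq_one : T c = 1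

theorem IsAcyclicRankThree.exists_isPositiveFlag [Finite E] [Nonempty E]
    (hC : IsAcyclicRankThree C) : ∃ a b c S T, IsPositiveFlag C a b c S T := by
  have hO := hC.isOrientedMatroid
  obtain ⟨a, -, S, hS, hSa, hSk⟩ := hO.exists_facet hC.one_mem (hO.2.1 _ hC.one_mem)
    (fun e => by
      obtain ⟨k⟩ := ‹Nonempty E›
      exact absurd (show (-1 : SignType) = 1 from congrFun e k) (by decide))
          (fun V _ k hk => absurd hk one_ne_zero)
    (fun k => Or.inr rfl)
  have hS1 : ∀ {k}, ¬Par C a k → S k = 1 := fun {k} hk => (hSk k).resolve_right fun h =>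
    hk fun V hV => by simpa using (h.2.2 V hV).symm
  have hL := hO.contraction a
  obtain ⟨b, hb, T, ⟨hT, hTa⟩, hTb, hTk⟩ := hL.exists_facet ⟨hS, hSa⟩ (hL.2.1 _ ⟨hS, hSa⟩)
    (fun e => by
      obtain ⟨k, hk⟩ := hC.exists_not_par a
      have := congrFun e k
      rw [Pi.neg_apply, hS1 hk] at this
      exact absurd this (by decide))
    (fun V hV k hk => by
      by_cases hp : Par C a k
      · rw [← hp V hV.1, hV.2]
      · rw [hS1 hp] at hk
        exact absurd hk one_ne_zero)
    (fun k => Or.inr rfl)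
  have hab : ¬Par C a b := fun hp => hb (by rw [← hp S hS, hSa])
  have hS0 : ∀ k, 0 ≤ S k := fun k => by
    by_cases hp : Par C a k
    · rw [← hp S hS, hSa]
    · rw [hS1 hp]; decide
  have hT0 : ∀ k, 0 ≤ T k := fun k => by
    rcases hTk k with h | ⟨h, -⟩
    · rw [h]; exact hS0 k
    · rw [h]
  obtain ⟨c, hc⟩ : ∃ c, T c ≠ 0 := by
    by_contra! h0
    obtain ⟨W, hW, hW0, hWa, hWb⟩ := hC.exists_cocircuit a b
    refine hW0 (funext fun k => ?_)
    by_cases hp : Par C a k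
    · rw [← hp W hW, hWa]; rfl
    · rcases hTk k with h | ⟨-, -, h⟩
      · rw [h0, hS1 hp] at h
        exact absurd h zero_ne_one
      · have := h W ⟨hW, hWa⟩
        rwa [hS1 hab, mul_one, hWb, zero_mul] at this
  refine ⟨a, b, c, S, T, hS, hSa, hS1, hab, hT, hTa, hTb, hT0, ?_⟩
  have := hT0 c
  generalize T c = t at *
  clear * - this hc
  revert t; decide

/-- The representative chosen from a pair of opposite cocircuits. -/
def IsNormal (a b c : E) (Y : E → SignType) : Prop :=
  Y a = 1 ∨ (Y a = 0 ∧ Y b = 1) ∨ (Y a = 0 ∧ Y b = 0 ∧ Y c = -1)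

theorem IsNormal.ne_zero {Y : E → SignType} (hY : IsNormal a b c Y) : Y ≠ 0 := by
  rintro rfl
  revert hY
  simp [IsNormal]

theorem IsNormal.ne_neg {Y Y' : E → SignType} (hY : IsNormal a b c Y) (hY' : IsNormal a b c Y') :
    Y ≠ -Y' := by
  rintro rfl
  unfold IsNormal at *
  simp only [Pi.neg_apply] at hY
  generalize Y' a = x at *
  generalize Y' b = y at *
  generalize Y' c = z at *
  revert x y z
  decide

namespace IsPositiveFlag

theorem eq_or_eq_neg_right (h : IsPositiveFlag C a b c S T) (hC : IsAcyclicRankThree C)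
    {Y : E → SignType} (hY : Y ∈ C) (ha : Y a = 0) (hb : Y b = 0) (h0 : Y ≠ 0) :
    Y = T ∨ Y = -T :=
  hC.eq_or_eq_neg h.not_par hY h.right_mem ha hb h.right_apex h.right_edge h0
    fun h0 => absurd ((congrFun h0 c).symm.trans h.right_eq_one) zero_ne_one

theorem isNormal_or (h : IsPositiveFlag C a b c S T) (hC : IsAcyclicRankThree C)
    {Y : E → SignType} (hY : Y ∈ C) (h0 : Y ≠ 0) : IsNormal a b c Y ∨ IsNormal a b c (-Y) := by
  have hc : Y a = 0 → Y b = 0 → Y c ≠ 0 := fun ha hb => by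
    rcases h.eq_or_eq_neg_right hC hY ha hb h0 with rfl | rfl
    · rw [h.right_eq_one]; decide
    · rw [Pi.neg_apply, h.right_eq_one]; decide
  unfold IsNormal
  simp only [Pi.neg_apply]
  generalize Y a = x at *
  generalize Y b = y at *
  generalize Y c = z at *
  clear * - hc
  revert x y z
  decide

theorem exists_isNormal (h : IsPositiveFlag C a b c S T) (hC : IsAcyclicRankThree C) (i j : E) :
    ∃ Y ∈ C, IsNormal a b c Y ∧ Y i = 0 ∧ Y j = 0 := by
  obtain ⟨Y, hY, h0, hi, hj⟩ := hC.exists_cocircuit i j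
  rcases h.isNormal_or hC hY h0 with h' | h'
  · exact ⟨Y, hY, h', hi, hj⟩
  · exact ⟨-Y, hC.isOrientedMatroid.2.1 Y hY, h', by simp [hi], by simp [hj]⟩

theorem _root_.IsAcyclicRankThree.eq_of_isNormal (hC : IsAcyclicRankThree C) {i j : E}
    (hij : ¬Par C i j) {Y Y' : E → SignType} (hY : Y ∈ C) (hY' : Y' ∈ C)
    (hN : IsNormal a b c Y) (hM : IsNormal a b c Y') (hi : Y i = 0) (hj : Y j = 0)
    (hi' : Y' i = 0) (hj' : Y' j = 0) : Y = Y' :=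
  (hC.eq_or_eq_neg hij hY hY' hi hj hi' hj' hN.ne_zero hM.ne_zero).resolve_right (hN.ne_neg hM)

/-- Elements vanishing on a common nonzero covector at `a` are parallel in the contraction of
`a`. -/
theorem apply_eq_apply (h : IsPositiveFlag C a b c S T) (hC : IsAcyclicRankThree C)
    {P V : E → SignType} (hP : P ∈ C) (hP0 : P ≠ 0) (hPa : P a = 0) (hV : V ∈ C) (hVa : V a = 0)
    {k l : E} (hk : ¬Par C a k) (hl : ¬Par C a l) (hPk : P k = 0) (hPl : P l = 0) :
    V k = V l := by
  have hzero : ∀ {k l}, ¬Par C a k → P k = 0 → P l = 0 → ∀ W ∈ C, W a = 0 → W k = 0 → W l = 0 := by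
    intro k l hk hPk hPl W hW hWa hWk
    by_cases hW0 : W = 0
    · rw [hW0]; rfl
    rcases hC.eq_or_eq_neg hk hW hP hWa hWk hPa hPk hW0 hP0 with rfl | rfl
    · exact hPl
    · rw [Pi.neg_apply, hPl]; rfl
  have hO := hC.isOrientedMatroid
  have key : ∀ W ∈ C, W a = 0 → W k = 1 → W l = 1 := by
    intro W hW hWa hWk
    obtain ⟨Z, hZ, hZk, hZ'⟩ := hO.exists_diff h.left_mem hW (e := k)
      (by rw [h.left_eq_one hk, hWk]) (by rw [h.left_eq_one hk]; decide)
    have hZl := hzero hk hPk hPl Z hZ ((hZ' a).2.2 h.left_apex hWa) hZk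
    by_contra hne
    have := (hZ' l).2.1 (by
      rw [h.left_eq_one hl]
      generalize W l = w at *
      clear * - hne
      revert w; decide)
    rw [hZl] at this
    exact zero_ne_one this
  have h1 := hzero hk hPk hPl V hV hVa
  have h2 := key V hV hVa
  have h3 := key (-V) (hO.2.1 V hV) (by simp [hVa])
  simp only [Pi.neg_apply] at h3
  generalize V k = x at *
  generalize V l = y at *
  clear * - h1 h2 h3
  revert x y; decide

theorem le_or_le (h : IsPositiveFlag C a b c S T) (hC : IsAcyclicRankThree C)
    {Y Y' : E → SignType} (hY : Y ∈ C) (hY' : Y' ∈ C) (hN : IsNormal a b c Y)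
    (hN' : IsNormal a b c Y') (ha : Y a = 0) (ha' : Y' a = 0) : Y ≤ Y' ∨ Y' ≤ Y := by
  have hT0 : T ≠ 0 := fun h0 => absurd ((congrFun h0 c).symm.trans h.right_eq_one) zero_ne_one
  have hlow : ∀ {Y Y' : E → SignType}, Y ∈ C → Y' ∈ C → IsNormal a b c Y → IsNormal a b c Y' →
      Y a = 0 → Y' a = 0 → Y b = 0 → Y ≤ Y' := by
    intro Y Y' hY hY' hN hN' ha ha' hb k
    have hYT : Y = -T := by
      rcases h.eq_or_eq_neg_right hC hY ha hb hN.ne_zero with rfl | h'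
      · unfold IsNormal at hN
        rw [ha, hb, h.right_eq_one] at hN
        exact absurd hN (by decide)
      · exact h'
    have hk : T k = 0 → 0 ≤ Y' k := by
      intro hTk
      by_cases hp : Par C a k
      · rw [← hp Y' hY', ha']
      · rw [h.apply_eq_apply hC h.right_mem hT0 h.right_apex hY' ha' hp h.not_par hTk h.right_edge]
        unfold IsNormal at hN'
        rw [ha'] at hN'
        rcases hN' with h' | ⟨-, h'⟩ | ⟨-, h', -⟩
        · exact absurd h' zero_ne_one
        · rw [h']; decide
        · rw [h']
    have := h.right_nonneg k
    change Y k ≤ Y' k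
    rw [hYT, Pi.neg_apply]
    generalize T k = x at *
    generalize Y' k = y at *
    clear * - this hk
    revert x y; decide
  by_cases hb : Y b = 0
  · exact Or.inl (hlow hY hY' hN hN' ha ha' hb)
  by_cases hb' : Y' b = 0
  · exact Or.inr (hlow hY' hY hN' hN ha' ha hb')
  have hone : ∀ {Y : E → SignType}, IsNormal a b c Y → Y a = 0 → Y b ≠ 0 → Y b = 1 := by
    intro Y hN ha hb
    rcases hN with h' | ⟨-, h'⟩ | ⟨-, h', -⟩
    · rw [ha] at h'
      exact absurd h' zero_ne_one
    · exact h'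
    · exact absurd h' hb
  obtain ⟨Z, hZ, hZb, hZ'⟩ := hC.isOrientedMatroid.exists_diff hY hY' (e := b)
    (by rw [hone hN ha hb, hone hN' ha' hb']) hb
  have hZs : (∀ k, 0 ≤ Z k) ∨ ∀ k, Z k ≤ 0 := by
    by_cases hZ0 : Z = 0
    · exact Or.inl fun k => by rw [hZ0]; rfl
    rcases h.eq_or_eq_neg_right hC hZ ((hZ' a).2.2 ha ha') hZb hZ0 with rfl | rfl
    · exact Or.inl h.right_nonneg
    · right
      intro k
      have := h.right_nonneg k
      rw [Pi.neg_apply]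
      generalize T k = x at *
      clear * - this
      revert x; decide
  rcases hZs with h' | h'
  · right
    intro k
    by_contra! hlt
    have := h' k
    rw [(hZ' k).1 hlt] at this
    exact absurd this (by decide)
  · left
    intro k
    by_contra! hlt
    have := h' k
    rw [(hZ' k).2.1 hlt] at this
    exact absurd this (by decide)

/-- Two normal covectors vanishing at `i` differ by a multiple of the one also vanishing at
`a`. -/
theorem _root_.IsAcyclicRankThree.lt_imp_or (hC : IsAcyclicRankThree C) {i : E}
    (hai : ¬Par C a i) {P Y Y' : E → SignType} (hP : P ∈ C) (hP0 : P ≠ 0) (hPa : P a = 0)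
    (hPi : P i = 0) (hY : Y ∈ C) (hY' : Y' ∈ C) (hi : Y i = 0) (hi' : Y' i = 0) (ha : Y a = 1)
    (ha' : Y' a = 1) : (∀ k, (Y k < Y' k → P k = -1) ∧ (Y' k < Y k → P k = 1)) ∨
      ∀ k, (Y k < Y' k → P k = 1) ∧ (Y' k < Y k → P k = -1) := by
  obtain ⟨Z, hZ, hZa, hZ'⟩ := hC.isOrientedMatroid.exists_diff hY hY' (ha.trans ha'.symm)
    (by rw [ha]; decide)
  by_cases hZ0 : Z = 0
  · left
    intro k
    have h1 := (hZ' k).1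
    have h2 := (hZ' k).2.1
    rw [hZ0] at h1 h2
    exact ⟨fun h => absurd (h1 h) (by rw [Pi.zero_apply]; decide),
      fun h => absurd (h2 h) (by rw [Pi.zero_apply]; decide)⟩
  rcases hC.eq_or_eq_neg hai hZ hP hZa ((hZ' i).2.2 hi hi') hPa hPi hZ0 hP0 with rfl | rfl
  · exact Or.inl fun k => ⟨(hZ' k).1, (hZ' k).2.1⟩
  · right
    intro k
    refine ⟨fun h => ?_, fun h => ?_⟩
    · exact neg_inj.1 ((hZ' k).1 h)
    · exact neg_eq_iff_eq_neg.1 ((hZ' k).2.1 h)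

end IsPositiveFlag

end Flag

section Order

variable {n : ℕ} {C : Set (Fin n → SignType)} {a b c : Fin n} {S T : Fin n → SignType}
  {P Q : Fin n → Fin n → SignType}

theorem exists_rank_function {α : Type*} [LinearOrder α] (f : Fin n → α) :
    ∃ pos : Fin n → ℕ, (∀ i j, f i = f j → pos i = pos j) ∧ ∀ i j, f i < f j → pos i < pos j := by
  refine ⟨fun i => (Finset.univ.filter fun k => f k < f i).card,
    fun i j hij => by simp only [hij], fun i j hij => Finset.card_lt_card ?_⟩
  rw [Finset.ssubset_iff_of_subset]
  · exact ⟨i, by simpa using hij, by simp⟩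
  · intro k
    simp only [Finset.mem_filter_univ]
    exact fun hk => hk.trans hij

/-- The conditions on a weak order of the elements under which the cocircuits become linearly
ordered along each element; `P i` is the normal cocircuit at `i` and `a`, and `Q i` a covector
vanishing at `i` and positive at `a`. -/
structure IsCompatibleOrder (C : Set (Fin n → SignType)) (a : Fin n)
    (P Q : Fin n → Fin n → SignType) (pos : Fin n → ℕ) : Prop where
  eq_of_par : ∀ {i k}, Par C i k → pos i = pos k
  apex_lt : ∀ {i k}, Par C a i → ¬Par C a k → pos i < pos k
  lt_of_one : ∀ {i k}, ¬Par C a i → ¬Par C a k → P i k = 1 → pos i < pos k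
  gt_of_neg_one : ∀ {i k}, ¬Par C a i → ¬Par C a k → P i k = -1 → pos k < pos i
  lt_of_neg_one : ∀ {i k}, ¬Par C a i → ¬Par C a k → P i k = 0 → Q i k = -1 → pos i < pos k
  gt_of_one : ∀ {i k}, ¬Par C a i → ¬Par C a k → P i k = 0 → Q i k = 1 → pos k < pos i
  par_of_zero : ∀ {i k}, ¬Par C a i → ¬Par C a k → P i k = 0 → Q i k = 0 → Par C i k

theorem IsAcyclicRankThree.apply_eq_of_apply_eq_zero (hC : IsAcyclicRankThree C) {i : Fin n}
    (hai : ¬Par C a i) {P Y Y' : Fin n → SignType} (hP : P ∈ C) (hP0 : P ≠ 0) (hPa : P a = 0)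
    (hPi : P i = 0) (hY : Y ∈ C) (hY' : Y' ∈ C) (hi : Y i = 0) (hi' : Y' i = 0) (ha : Y a = 1)
    (ha' : Y' a = 1) {k : Fin n} (hk : P k = 0) : Y k = Y' k := by
  rcases hC.lt_imp_or hai hP hP0 hPa hPi hY hY' hi hi' ha ha' with h | h <;>
  · have := h k
    rw [hk] at this
    generalize Y k = x at *
    generalize Y' k = y at *
    clear * - this
    revert x y; decide

theorem IsPositiveFlag.exists_isCompatibleOrder (h : IsPositiveFlag C a b c S T)
    (hC : IsAcyclicRankThree C)
    (hP : ∀ i, ¬Par C a i → P i ∈ C ∧ IsNormal a b c (P i) ∧ P i i = 0 ∧ P i a = 0)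
    (hQ : ∀ i, ¬Par C a i → Q i ∈ C ∧ Q i i = 0 ∧ Q i a = 1) :
    ∃ pos, IsCompatibleOrder C a P Q pos := by
  classical
  have hPeq : ∀ {i k}, ¬Par C a i → ¬Par C a k → P i k = 0 → P k = P i := by
    intro i k hi hk hik
    obtain ⟨h1, h2, -, h3⟩ := hP i hi
    obtain ⟨h4, h5, h6, h7⟩ := hP k hk
    exact hC.eq_of_isNormal hk h4 h1 h5 h2 h7 h6 h3 hik
  have hQeq : ∀ {i k}, ¬Par C a i → ¬Par C a k → P i k = 0 → Q i k = 0 →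
      ∀ l, P i l = 0 → Q i l = Q k l := by
    intro i k hi hk hik hQik l hl
    obtain ⟨h1, h2, -, h3⟩ := hP i hi
    obtain ⟨h4, -, h5⟩ := hQ i hi
    obtain ⟨h6, h7, h8⟩ := hQ k hk
    exact hC.apply_eq_of_apply_eq_zero hk h1 h2.ne_zero h3 hik h4 h6 hQik h7 h5 h8 hl
  have hPlt : ∀ {Y Y' : Fin n → SignType}, Y ∈ C → Y' ∈ C → IsNormal a b c Y →
      IsNormal a b c Y' → Y a = 0 → Y' a = 0 → ∀ k, Y k < Y' k →
        ∑ l, (Y l : ℤ) < ∑ l, (Y' l : ℤ) := by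
    intro Y Y' hY hY' hN hN' ha ha' k hk
    have hle := (h.le_or_le hC hY hY' hN hN' ha ha').resolve_right fun hle => (hle k).not_gt hk
    exact Finset.sum_lt_sum (fun l _ => not_lt.1 (mt SignType.intCast_lt.1 (not_lt.2 (hle l))))
      ⟨k, Finset.mem_univ k, SignType.intCast_lt.2 hk⟩
  set B : Fin n → Finset (Fin n) := fun i => Finset.univ.filter fun l => ¬Par C a l ∧ P i l = 0
    with hB
  have hQle : ∀ {i k}, ¬Par C a i → ¬Par C a k → P i k = 0 →
      (∀ l ∈ B i, Q i l ≤ Q k l) ∨ (∀ l ∈ B i, Q k l ≤ Q i l) := by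
    intro i k hi hk hik
    obtain ⟨h1, h2, -, h3⟩ := hP i hi
    obtain ⟨h4, -, h5⟩ := hQ i hi
    obtain ⟨h6, h7, h8⟩ := hQ k hk
    obtain ⟨Z, hZ, hZa, hZ'⟩ := hC.isOrientedMatroid.exists_diff h4 h6 (e := a)
      (h5.trans h8.symm) (by rw [h5]; decide)
    have hZk : ∀ l ∈ B i, Z l = Z k := fun l hl => by
      rw [hB, Finset.mem_filter_univ] at hl
      exact h.apply_eq_apply hC h1 h2.ne_zero h3 hZ hZa hl.1 hk hl.2 hik
    by_cases hs : Z k = 1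
    · right
      intro l hl
      by_contra! hlt
      have := (hZ' l).1 hlt
      rw [hZk l hl, hs] at this
      exact absurd this (by decide)
    · left
      intro l hl
      by_contra! hlt
      exact hs ((hZk l hl).symm.trans ((hZ' l).2.1 hlt))
  have hQlt : ∀ {u v : Fin n → SignType} {s : Finset (Fin n)},
      (∀ l ∈ s, u l ≤ v l) ∨ (∀ l ∈ s, v l ≤ u l) → ∀ k ∈ s, u k < v k →
        ∑ l ∈ s, (u l : ℤ) < ∑ l ∈ s, (v l : ℤ) := by
    intro u v s hle k hk hlt
    replace hle := hle.resolve_right fun hle => (hle k hk).not_gt hlt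
    exact Finset.sum_lt_sum (fun l hl => not_lt.1 (mt SignType.intCast_lt.1
      (not_lt.2 (hle l hl)))) ⟨k, hk, SignType.intCast_lt.2 hlt⟩
  have hBeq : ∀ {i k}, ¬Par C a i → ¬Par C a k → P i k = 0 → B k = B i := fun hi hk hik => by
    simp only [hB, hPeq hi hk hik]
  obtain ⟨pos, hpos, hlt⟩ := exists_rank_function fun i => if Par C a i then
    toLex (-(n + 1 : ℤ), (0 : ℤ)) else toLex (-∑ l, (P i l : ℤ), ∑ l ∈ B i, (Q i l : ℤ))
  have hposP : ∀ {i k}, ¬Par C a i → ¬Par C a k → ∑ l, (P k l : ℤ) < ∑ l, (P i l : ℤ) →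
      pos i < pos k := fun {i k} hi hk hik => hlt i k (by
    rw [if_neg hi, if_neg hk, Prod.Lex.toLex_lt_toLex]
    exact Or.inl (neg_lt_neg hik))
  have hposQ : ∀ {i k}, ¬Par C a i → ¬Par C a k → P i k = 0 →
      ∑ l ∈ B i, (Q i l : ℤ) < ∑ l ∈ B i, (Q k l : ℤ) → pos i < pos k :=
    fun {i k} hi hk h0 hik => hlt i k (by
      rw [if_neg hi, if_neg hk, Prod.Lex.toLex_lt_toLex, hPeq hi hk h0, hBeq hi hk h0]
      exact Or.inr ⟨rfl, hik⟩)
  have hmemB : ∀ {i k}, ¬Par C a k → P i k = 0 → k ∈ B i := fun hk h0 => by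
    rw [hB, Finset.mem_filter_univ]
    exact ⟨hk, h0⟩
  refine ⟨pos, ?_, ?_, ?_, ?_, ?_, ?_, ?_⟩
  · intro i k hik
    refine hpos i k ?_
    by_cases hi : Par C a i
    · rw [if_pos hi, if_pos (hi.trans hik)]
    have hk : ¬Par C a k := fun hk => hi (hk.trans hik.symm)
    have h0 : P i k = 0 := by rw [← hik _ (hP i hi).1, (hP i hi).2.2.1]
    have h0' : Q i k = 0 := by rw [← hik _ (hQ i hi).1, (hQ i hi).2.1]
    have hS : ∑ l ∈ B i, (Q i l : ℤ) = ∑ l ∈ B i, (Q k l : ℤ) :=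
      Finset.sum_congr rfl fun l hl => by
        rw [hB, Finset.mem_filter_univ] at hl
        rw [hQeq hi hk h0 h0' l hl.2]
    rw [if_neg hi, if_neg hk, hPeq hi hk h0, hBeq hi hk h0, hS]
  · intro i k hi hk
    refine hlt i k ?_
    rw [if_pos hi, if_neg hk, Prod.Lex.toLex_lt_toLex]
    left
    have : ∑ l, (P k l : ℤ) ≤ ∑ l : Fin n, 1 := Finset.sum_le_sum fun l _ => by
      generalize P k l = x
      revert x; decide
    simp only [Finset.sum_const, Finset.card_univ, Fintype.card_fin, nsmul_eq_mul, mul_one] at this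
    simp only
    omega
  · intro i k hi hk hik
    obtain ⟨h1, h2, -, h3⟩ := hP i hi
    obtain ⟨h4, h5, h6, h7⟩ := hP k hk
    exact hposP hi hk (hPlt h4 h1 h5 h2 h7 h3 k (by rw [h6, hik]; decide))
  · intro i k hi hk hik
    obtain ⟨h1, h2, -, h3⟩ := hP i hi
    obtain ⟨h4, h5, h6, h7⟩ := hP k hk
    exact hposP hk hi (hPlt h1 h4 h2 h5 h3 h7 k (by rw [h6, hik]; decide))
  · intro i k hi hk h0 hik
    exact hposQ hi hk h0 (hQlt (hQle hi hk h0) k (hmemB hk h0)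
      (by rw [(hQ k hk).2.1, hik]; decide))
  · intro i k hi hk h0 hik
    have h0' : P k i = 0 := by rw [hPeq hi hk h0, (hP i hi).2.2.1]
    refine hposQ hk hi h0' ?_
    rw [hBeq hi hk h0]
    exact hQlt (hQle hi hk h0).symm k (hmemB hk h0) (by rw [(hQ k hk).2.1, hik]; decide)
  · intro i k hi hk h0 hik
    by_contra hp
    obtain ⟨h1, h2, h3, h4⟩ := hP i hi
    obtain ⟨h5, h6, h7⟩ := hQ i hi
    have hQn : IsNormal a b c (Q i) := Or.inl h7
    have := hC.eq_of_isNormal hp h1 h5 h2 hQn h3 h0 h6 hik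
    rw [this, h7] at h4
    exact one_ne_zero h4

theorem IsPositiveFlag.comparable (h : IsPositiveFlag C a b c S T) (hC : IsAcyclicRankThree C)
    (hP : ∀ i, ¬Par C a i → P i ∈ C ∧ IsNormal a b c (P i) ∧ P i i = 0 ∧ P i a = 0)
    (hQ : ∀ i, ¬Par C a i → Q i ∈ C ∧ Q i i = 0 ∧ Q i a = 1) {pos : Fin n → ℕ}
    (hpos : IsCompatibleOrder C a P Q pos) {i : Fin n} {Y Y' : Fin n → SignType} (hY : Y ∈ C)
    (hY' : Y' ∈ C) (hN : IsNormal a b c Y) (hN' : IsNormal a b c Y') (hi : Y i = 0)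
    (hi' : Y' i = 0) :
    (∀ l, (pos i < pos l → Y l ≤ Y' l) ∧ (pos l < pos i → Y' l ≤ Y l)) ∨
    (∀ l, (pos i < pos l → Y' l ≤ Y l) ∧ (pos l < pos i → Y l ≤ Y' l)) := by
  by_cases hai : Par C a i
  · have hmin : ∀ l, ¬pos l < pos i := by
      intro l
      by_cases hl : Par C a l
      · exact (hpos.eq_of_par (hl.symm.trans hai)).not_lt
      · exact (hpos.apex_lt hai hl).not_gt
    rcases h.le_or_le hC hY hY' hN hN' ((hai Y hY).trans hi) ((hai Y' hY').trans hi')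
      with hle | hle
    · exact Or.inl fun l => ⟨fun _ => hle l, fun hl => absurd hl (hmin l)⟩
    · exact Or.inr fun l => ⟨fun _ => hle l, fun hl => absurd hl (hmin l)⟩
  obtain ⟨hPC, hPN, hPi, hPa⟩ := hP i hai
  obtain ⟨hQC, hQi, hQa⟩ := hQ i hai
  have hnp : ∀ {l}, P i l ≠ 0 → ¬Par C a l := fun hl hp => hl (by rw [← hp _ hPC, hPa])
  have hone : ∀ {Y Y' : Fin n → SignType},
      (∀ k, (Y k < Y' k → P i k = -1) ∧ (Y' k < Y k → P i k = 1)) → ∀ l,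
      (pos i < pos l → Y' l ≤ Y l) ∧ (pos l < pos i → Y l ≤ Y' l) := by
    intro Y Y' hlt l
    refine ⟨fun hl => ?_, fun hl => ?_⟩
    · by_contra! hYl
      have := (hlt l).1 hYl
      exact hl.not_gt (hpos.gt_of_neg_one hai (hnp (by rw [this]; decide)) this)
    · by_contra! hYl
      have := (hlt l).2 hYl
      exact hl.not_gt (hpos.lt_of_one hai (hnp (by rw [this]; decide)) this)
  have hlow : ∀ {Y}, Y ∈ C → Y i = 0 → Y a = 1 → ∀ l,
      (pos i < pos l → Y l ≤ P i l) ∧ (pos l < pos i → P i l ≤ Y l) := by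
    intro Y hY hi ha l
    have hYQ : P i l = 0 → Y l = Q i l :=
      hC.apply_eq_of_apply_eq_zero hai hPC hPN.ne_zero hPa hPi hY hQC hi hQi ha hQa
    by_cases hl : Par C a l
    · refine ⟨fun hlt => absurd hlt (hpos.apex_lt hl hai).not_gt, fun _ => ?_⟩
      rw [← hl _ hPC, ← hl Y hY, ha, hPa]
      decide
    have h1 := hpos.lt_of_one hai hl
    have h2 := hpos.gt_of_neg_one hai hl
    have h3 := hpos.lt_of_neg_one hai hl
    have h4 := hpos.gt_of_one hai hl
    have key : (P i l = -1 ∧ pos l < pos i) ∨ (P i l = 1 ∧ pos i < pos l) ∨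
        (P i l = 0 ∧ (Y l = 0 ∨ (Y l = -1 ∧ pos i < pos l) ∨ (Y l = 1 ∧ pos l < pos i))) := by
      rcases hPil : P i l with _ | _ | _
      · right; right
        refine ⟨rfl, ?_⟩
        rw [hYQ hPil]
        rcases hQil : Q i l with _ | _ | _
        · exact Or.inl rfl
        · exact Or.inr (Or.inl ⟨rfl, h3 hPil hQil⟩)
        · exact Or.inr (Or.inr ⟨rfl, h4 hPil hQil⟩)
      · exact Or.inl ⟨rfl, h2 hPil⟩
      · exact Or.inr (Or.inl ⟨rfl, h1 hPil⟩)
    rcases key with ⟨e, hl⟩ | ⟨e, hl⟩ | ⟨e, e' | ⟨e', hl⟩ | ⟨e', hl⟩⟩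
    · refine ⟨fun hl' => absurd hl hl'.not_gt, fun _ => ?_⟩
      rw [e]
      generalize Y l = y
      revert y; decide
    · refine ⟨fun _ => ?_, fun hl' => absurd hl hl'.not_gt⟩
      rw [e]
      generalize Y l = y
      revert y; decide
    · rw [e, e']
      exact ⟨fun _ => le_rfl, fun _ => le_rfl⟩
    · refine ⟨fun _ => ?_, fun hl' => absurd hl hl'.not_gt⟩
      rw [e, e']; decide
    · refine ⟨fun hl' => absurd hl hl'.not_gt, fun _ => ?_⟩
      rw [e, e']; decide
  have hcases : ∀ {Y}, Y ∈ C → IsNormal a b c Y → Y i = 0 → Y a = 1 ∨ Y = P i := by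
    intro Y hY hN hi
    rcases hN with ha | hN
    · exact Or.inl ha
    · exact Or.inr (hC.eq_of_isNormal hai hY hPC (Or.inr hN) hPN (hN.elim And.left And.left)
        hi hPa hPi)
  rcases hcases hY hN hi with ha | rfl
  · rcases hcases hY' hN' hi' with ha' | rfl
    · rcases hC.lt_imp_or hai hPC hPN.ne_zero hPa hPi hY hY' hi hi' ha ha' with hlt | hlt
      · exact Or.inr (hone hlt)
      · exact Or.inl (hone fun k => ⟨(hlt k).2, (hlt k).1⟩)
    · exact Or.inl (hlow hY hi ha)
  · rcases hcases hY' hN' hi' with ha' | rfl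
    · exact Or.inr (hlow hY' hi' ha')
    · exact Or.inl fun l => ⟨fun _ => le_rfl, fun _ => le_rfl⟩

theorem IsAcyclicRankThree.exists_sweepData (hC : IsAcyclicRankThree C) :
    ∃ pos V, SweepData C pos V := by
  classical
  rcases isEmpty_or_nonempty (Fin n) with hn | hn
  · exact ⟨fun _ => 0, fun _ _ => 0, isEmptyElim, isEmptyElim, fun {i} => isEmptyElim i,
      fun {i} => isEmptyElim i, fun {i} => isEmptyElim i, fun {i} => isEmptyElim i,
      fun {i} => isEmptyElim i, fun {i} => isEmptyElim i⟩
  obtain ⟨a, b, c, S, T, h⟩ := hC.exists_isPositiveFlag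
  choose W hWC hWN hWl hWr using h.exists_isNormal hC
  set V : Fin n → Fin n → Fin n → SignType := fun i j => if Par C i j then 0 else W i j with hV
  have hVW : ∀ {i j}, ¬Par C i j → V i j = W i j := fun hij => if_neg hij
  choose Q hQ using fun i => show ∃ U, ¬Par C a i → U ∈ C ∧ U i = 0 ∧ U a = 1 by
    by_cases hi : Par C a i
    · exact ⟨0, fun h => absurd hi h⟩
    · obtain ⟨U, hU⟩ := hC.isOrientedMatroid.exists_eq_zero_eq_one hC.one_mem
        fun hp => hi hp.symm
      exact ⟨U, fun _ => hU⟩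
  have hP : ∀ i, ¬Par C a i →
      W i a ∈ C ∧ IsNormal a b c (W i a) ∧ W i a i = 0 ∧ W i a a = 0 :=
    fun i _ => ⟨hWC i a, hWN i a, hWl i a, hWr i a⟩
  obtain ⟨pos, hpos⟩ := h.exists_isCompatibleOrder hC hP hQ
  refine ⟨pos, V, ?_, ?_, ?_, ?_, ?_, ?_, ?_, ?_⟩
  · refine fun i j => ⟨fun hij => ?_, hpos.eq_of_par⟩
    by_cases hi : Par C a i
    · by_cases hj : Par C a j
      · exact hi.symm.trans hj
      · exact absurd hij (hpos.apex_lt hi hj).ne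
    · by_cases hj : Par C a j
      · exact absurd hij (hpos.apex_lt hj hi).ne'
      · rcases hWij : W i a j with _ | _ | _
        · rcases hQij : Q i j with _ | _ | _
          · exact hpos.par_of_zero hi hj hWij hQij
          · exact absurd hij (hpos.lt_of_neg_one hi hj hWij hQij).ne
          · exact absurd hij (hpos.gt_of_one hi hj hWij hQij).ne'
        · exact absurd hij (hpos.gt_of_neg_one hi hj hWij).ne'
        · exact absurd hij (hpos.lt_of_one hi hj hWij).ne
  · intro i j
    by_cases hij : Par C i j
    · simp only [hV, if_pos hij, if_pos hij.symm]
    · rw [hVW hij, hVW fun hp => hij hp.symm]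
      exact hC.eq_of_isNormal hij (hWC i j) (hWC j i) (hWN i j) (hWN j i) (hWl i j) (hWr i j)
        (hWr j i) (hWl j i)
  · intro i j hij
    rw [hVW hij]
    exact hWC i j
  · intro i j hij
    rw [hVW hij]
    exact hWl i j
  · intro i j hij
    rw [hVW hij]
    exact hWr i j
  · intro i j hij
    rw [hVW hij]
    exact (hWN i j).ne_zero
  · intro i j k hij hik h0
    rw [hVW hij] at h0 ⊢
    rw [hVW hik]
    exact hC.eq_of_isNormal hik (hWC i j) (hWC i k) (hWN i j) (hWN i k) (hWl i j) h0
      (hWl i k) (hWr i k)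
  · intro i j k hij hik
    rw [hVW hij, hVW hik]
    exact h.comparable hC hP hQ hpos (hWC i j) (hWC i k) (hWN i j) (hWN i k) (hWl i j) (hWl i k)

end Order

/-- Every loopless acyclic oriented matroid of rank `3` is the little oriented
matroid of some sweep oriented matroid. -/
theorem rank3_is_little {n : ℕ} (C : Set (Fin n → SignType))
    (hOM : IsOrientedMatroid C) (hrank : HasRank C 3)
    (hloopless : ∀ i : Fin n, ∃ X ∈ C, X i ≠ 0)
    (hacyclic : (fun _ => (1 : SignType)) ∈ C ∧
      ∀ Y ∈ C, covLE (fun _ => (1 : SignType)) Y → Y = fun _ => (1 : SignType)) :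
    ∃ M : Set (Pairs n → SignType),
      IsOrientedMatroid M ∧ (∀ X ∈ M, IsBraidCovector X) ∧
      LittleCovectors M = C := by
  have hC := hrank.isAcyclicRankThree hOM hacyclic.1
  obtain ⟨pos, V, h⟩ := hC.exists_sweepData
  exact ⟨_, isOrientedMatroid_sweepCovectors pos (pairSlope pos V), fun _ => h.isBraidCovector,
    h.littleCovectors_eq hC⟩
end
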